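/- arXiv:2201.13159 — 3 statements merged into one kernel-verified Lean document; each statement's English description precedes it below -/
import Mathlib

section
/- Let s ∈ (0,1), μ ∈ ℝ, P ∈ (0, ∞), and let φ be an even, P-periodic, nonconstant solution of the steady fKdV equation with wave speed μ which is nondecreasing on (−P/2, 0), satisfies φ(x) ≤ μ for all x, and attains the maximal height φ(0) = μ. Then φ is globally s-Hölder continuous on ℝ, and there exist constants c, C, δ > 0 such that c·|x|^s ≤ μ − φ(x) ≤ C·|x|^s for all |x| ≤ δ. -/
open MeasureTheory Set

/-- The Bessel kernel `K_s`. -/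
noncomputable def besselKernel (s x : ℝ) : ℝ :=
  (1 / (2 * Real.sqrt Real.pi * Real.Gamma (s / 2))) *
    ∫ t in Set.Ioi (0 : ℝ), Real.exp (-t - x ^ 2 / (4 * t)) * t ^ ((s - 3) / 2)

/-- A solution of the steady fKdV equation with wave speed `μ`: a bounded continuous
function satisfying the equation pointwise. -/
def IsFKdVSolution (s μ : ℝ) (φ : ℝ → ℝ) : Prop :=
  Continuous φ ∧ (∃ M, ∀ x, |φ x| ≤ M) ∧
    ∀ x, -μ * φ x + (φ x) ^ 2 / 2 + (∫ y, besselKernel s (x - y) * φ y) = 0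

namespace FKdV

/-- The normalising constant of the kernel. -/
noncomputable def cst (s : ℝ) : ℝ := 1 / (2 * Real.sqrt Real.pi * Real.Gamma (s / 2))

/-- The integrand of the kernel. -/
noncomputable def igd (s x t : ℝ) : ℝ := Real.exp (-t - x ^ 2 / (4 * t)) * t ^ ((s - 3) / 2)

lemma bessel_eq (s x : ℝ) : besselKernel s x = cst s * ∫ t in Ioi (0 : ℝ), igd s x t := rfl

lemma cst_pos {s : ℝ} (hs : 0 < s) : 0 < cst s := by
  unfold cst
  have := Real.Gamma_pos_of_pos (half_pos hs)
  have := Real.sqrt_pos.2 Real.pi_pos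
  positivity

lemma igd_nonneg (s x t : ℝ) (ht : 0 < t) : 0 ≤ igd s x t := by unfold igd; positivity

lemma K_even (s x : ℝ) : besselKernel s (-x) = besselKernel s x := by
  simp [besselKernel]

lemma K_abs (s x : ℝ) : besselKernel s |x| = besselKernel s x := by
  simp [besselKernel]

lemma K_nonneg {s : ℝ} (hs : 0 < s) (x : ℝ) : 0 ≤ besselKernel s x := by
  rw [bessel_eq]
  exact mul_nonneg (cst_pos hs).le
    (setIntegral_nonneg measurableSet_Ioi fun t ht => igd_nonneg s x t ht)

lemma igd_meas (s : ℝ) : Measurable (fun p : ℝ × ℝ => igd s p.1 p.2) := by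
  unfold igd; fun_prop

lemma igd_meas' (s x : ℝ) : Measurable (igd s x) := by
  unfold igd; fun_prop

lemma K_meas (s : ℝ) : Measurable (besselKernel s) := by
  have h : StronglyMeasurable (fun x => ∫ t in Ioi (0 : ℝ), igd s x t) :=
    (igd_meas s).stronglyMeasurable.integral_prod_right (f := igd s)
  exact h.measurable.const_mul (cst s)

lemma exp_neg_le_inv {z : ℝ} (hz : 0 < z) : Real.exp (-z) ≤ z⁻¹ := by
  rw [Real.exp_neg]
  exact inv_anti₀ hz (by linarith [Real.add_one_le_exp z])

lemma igd_le {s x t : ℝ} (hx : 0 < x) (ht : 0 < t) :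
    igd s x t ≤ (4 / x ^ 2) * (Real.exp (-t) * t ^ ((s + 1) / 2 - 1)) := by
  have h1 : Real.exp (-(x ^ 2 / (4 * t))) ≤ (x ^ 2 / (4 * t))⁻¹ := exp_neg_le_inv (by positivity)
  have h2 : t ^ ((s + 1) / 2 - 1) = t * t ^ ((s - 3) / 2) := by
    have h3 : (s + 1) / 2 - 1 = 1 + (s - 3) / 2 := by ring
    rw [h3, Real.rpow_add ht, Real.rpow_one]
  unfold igd
  rw [sub_eq_add_neg, Real.exp_add, h2]
  calc _ ≤ Real.exp (-t) * (x ^ 2 / (4 * t))⁻¹ * t ^ ((s - 3) / 2) := by gcongr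
    _ = _ := by rw [inv_div]; ring

lemma igd_int {s x : ℝ} (hs : 0 < s) (hx : 0 < x) : IntegrableOn (igd s x) (Ioi 0) := by
  have h := (Real.GammaIntegral_convergent (s := (s + 1) / 2) (by linarith)).const_mul (4 / x ^ 2)
  refine h.mono' (igd_meas' s x).aestronglyMeasurable ?_
  filter_upwards [ae_restrict_mem measurableSet_Ioi] with t ht
  rw [Real.norm_of_nonneg (igd_nonneg s x t ht)]
  exact igd_le hx ht

/-- Decay at infinity. -/
lemma K_le_inv_sq {s : ℝ} (hs : 0 < s) : ∃ C, 0 < C ∧ ∀ x, 0 < x → besselKernel s x ≤ C / x ^ 2 := by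
  refine ⟨cst s * 4 * Real.Gamma ((s + 1) / 2), ?_, fun x hx => ?_⟩
  · have := cst_pos hs
    have := Real.Gamma_pos_of_pos (s := (s + 1) / 2) (by linarith)
    positivity
  · rw [bessel_eq, Real.Gamma_eq_integral (by linarith), mul_assoc, mul_div_assoc]
    refine mul_le_mul_of_nonneg_left ?_ (cst_pos hs).le
    rw [mul_div_right_comm, ← integral_const_mul]
    refine setIntegral_mono_on (igd_int hs hx)
      ((Real.GammaIntegral_convergent (s := (s + 1) / 2) (by linarith)).const_mul _)
      measurableSet_Ioi fun t ht => igd_le hx ht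

/-- Singularity at zero. -/
lemma K_le_rpow {s : ℝ} (hs : 0 < s) (hs1 : s < 1) :
    ∃ C, 0 < C ∧ ∀ x, 0 < x → besselKernel s x ≤ C * x ^ (s - 1) := by
  have hc := cst_pos hs
  have h1s : 0 < 1 - s := by linarith
  refine ⟨cst s * (8 / (s + 1) + 2 / (1 - s)), by positivity, fun x hx => ?_⟩
  rw [bessel_eq, mul_assoc]
  refine mul_le_mul_of_nonneg_left ?_ hc.le
  have hx2 : 0 < x ^ 2 := by positivity
  have hI := igd_int hs hx
  have hsplit : ∫ t in Ioi (0 : ℝ), igd s x t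
      = (∫ t in Ioc 0 (x ^ 2), igd s x t) + ∫ t in Ioi (x ^ 2), igd s x t := by
    rw [← setIntegral_union (Ioc_disjoint_Ioi le_rfl) measurableSet_Ioi
      (hI.mono_set Ioc_subset_Ioi_self) (hI.mono_set (Ioi_subset_Ioi hx2.le)),
      Ioc_union_Ioi_eq_Ioi hx2.le]
  have hr : ∀ a : ℝ, (x ^ 2) ^ a = x ^ (2 * a) := fun a => by
    rw [← Real.rpow_natCast x 2, ← Real.rpow_mul hx.le]; norm_num
  have hA : ∫ t in Ioc 0 (x ^ 2), igd s x t ≤ 8 / (s + 1) * x ^ (s - 1) := by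
    have hi : IntervalIntegrable (fun t : ℝ => 4 / x ^ 2 * t ^ ((s - 1) / 2)) volume 0 (x ^ 2) :=
      (intervalIntegral.intervalIntegrable_rpow' (by linarith)).const_mul _
    calc ∫ t in Ioc 0 (x ^ 2), igd s x t ≤ ∫ t in Ioc 0 (x ^ 2), 4 / x ^ 2 * t ^ ((s - 1) / 2) := by
          refine setIntegral_mono_on (hI.mono_set Ioc_subset_Ioi_self) ?_ measurableSet_Ioc ?_
          · exact (intervalIntegrable_iff_integrableOn_Ioc_of_le hx2.le).1 hi
          · intro t ht
            refine (igd_le hx ht.1).trans ?_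
            have : Real.exp (-t) ≤ 1 := Real.exp_le_one_iff.2 (by linarith [ht.1])
            have h3 : (s + 1) / 2 - 1 = (s - 1) / 2 := by ring
            rw [h3]
            have := Real.rpow_nonneg ht.1.le ((s - 1) / 2)
            gcongr
            nlinarith
      _ = 8 / (s + 1) * x ^ (s - 1) := by
          rw [← intervalIntegral.integral_of_le hx2.le, intervalIntegral.integral_const_mul,
            integral_rpow (Or.inl (by linarith)), Real.zero_rpow (by linarith), hr]
          have : 2 * ((s - 1) / 2 + 1) = (s - 1) + 2 := by ring
          rw [this, Real.rpow_add hx]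
          have h4 : (s - 1) / 2 + 1 = (s + 1) / 2 := by ring
          rw [h4]
          norm_num
          field_simp
          norm_num
  have hB : ∫ t in Ioi (x ^ 2), igd s x t ≤ 2 / (1 - s) * x ^ (s - 1) := by
    calc ∫ t in Ioi (x ^ 2), igd s x t ≤ ∫ t in Ioi (x ^ 2), t ^ ((s - 3) / 2) := by
          refine setIntegral_mono_on (hI.mono_set (Ioi_subset_Ioi hx2.le))
            (integrableOn_Ioi_rpow_of_lt (by linarith) hx2) measurableSet_Ioi ?_
          intro t ht
          have ht0 : 0 < t := hx2.trans ht
          unfold igd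
          refine mul_le_of_le_one_left (by positivity) (Real.exp_le_one_iff.2 ?_)
          have : 0 ≤ x ^ 2 / (4 * t) := by positivity
          linarith
      _ = 2 / (1 - s) * x ^ (s - 1) := by
          rw [integral_Ioi_rpow_of_lt (by linarith) hx2, hr]
          have : 2 * ((s - 3) / 2 + 1) = (s - 1) := by ring
          rw [this]
          have : (s - 3) / 2 + 1 = -((1 - s) / 2) := by ring
          rw [this]
          field_simp
  rw [hsplit, add_mul]
  exact add_le_add hA hB

/-- Lower bound on a difference. -/
lemma K_diff_ge {s : ℝ} (hs : 0 < s) (hs1 : s < 1) :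
    ∃ c, 0 < c ∧ ∀ x, 0 < x → x ≤ 1 →
      c * x ^ (s - 1) ≤ besselKernel s x - besselKernel s (2 * x) := by
  have hc := cst_pos hs
  set k : ℝ := Real.exp (-2) * (Real.exp (-1) * (3 / 8)) * 2 ^ ((s - 3) / 2) with hk
  have hkpos : 0 < k := by positivity
  refine ⟨cst s * k, by positivity, fun x hx hx1 => ?_⟩
  rw [bessel_eq, bessel_eq, ← mul_sub, mul_assoc]
  refine mul_le_mul_of_nonneg_left ?_ hc.le
  have hx2 : 0 < x ^ 2 := by positivity
  have hI := igd_int hs hx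
  have hI2 := igd_int (x := 2 * x) hs (by positivity)
  have hr : (2 * x ^ 2) ^ ((s - 3) / 2) = 2 ^ ((s - 3) / 2) * x ^ (s - 3) := by
    rw [Real.mul_rpow (by norm_num) hx2.le, ← Real.rpow_natCast x 2, ← Real.rpow_mul hx.le]
    congr 2; push_cast; ring
  have hfac : ∀ t, 0 < t → igd s x t - igd s (2 * x) t = Real.exp (-t) *
      (Real.exp (-(x ^ 2 / (4 * t))) - Real.exp (-(x ^ 2 / t))) * t ^ ((s - 3) / 2) := by
    intro t ht
    unfold igd
    rw [sub_eq_add_neg (-t), sub_eq_add_neg (-t), Real.exp_add, Real.exp_add]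
    have : (2 * x) ^ 2 / (4 * t) = x ^ 2 / t := by field_simp; ring
    rw [this]; ring
  have hnn : ∀ t, 0 < t → 0 ≤ igd s x t - igd s (2 * x) t := by
    intro t ht
    rw [hfac t ht]
    have : Real.exp (-(x ^ 2 / t)) ≤ Real.exp (-(x ^ 2 / (4 * t))) := by
      apply Real.exp_le_exp.2
      apply neg_le_neg
      apply div_le_div_of_nonneg_left hx2.le ht (by linarith)
    have := sub_nonneg.2 this
    positivity
  have hlow : ∀ t ∈ Ioc (x ^ 2) (2 * x ^ 2), k * x ^ (s - 3) ≤ igd s x t - igd s (2 * x) t := by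
    intro t ht
    have ht0 : 0 < t := hx2.trans ht.1
    rw [hfac t ht0]
    have h1 : Real.exp (-2) ≤ Real.exp (-t) := Real.exp_le_exp.2 (by nlinarith [ht.2])
    have h2 : Real.exp (-1) * (3 / 8) ≤
        Real.exp (-(x ^ 2 / (4 * t))) - Real.exp (-(x ^ 2 / t)) := by
      have e1 : x ^ 2 / (4 * t) = (x ^ 2 / t) / 4 := by field_simp
      set b := x ^ 2 / t with hb
      have hb1 : b ≤ 1 := by rw [hb, div_le_one ht0]; exact ht.1.le
      have hb2 : 1 / 2 ≤ b := by rw [hb, le_div_iff₀ ht0]; linarith [ht.2]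
      have e2 : Real.exp (-(b / 4)) = Real.exp (-b) * Real.exp (3 * b / 4) := by
        rw [← Real.exp_add]; congr 1; ring
      have e3 := Real.add_one_le_exp (3 * b / 4)
      have e4 : Real.exp (-1) ≤ Real.exp (-b) := Real.exp_le_exp.2 (by linarith)
      rw [e1, e2]
      have e5 := Real.exp_pos (-1)
      calc Real.exp (-1) * (3 / 8) ≤ Real.exp (-b) * (Real.exp (3 * b / 4) - 1) := by
            gcongr; linarith
        _ = _ := by ring
    have h3 : 2 ^ ((s - 3) / 2) * x ^ (s - 3) ≤ t ^ ((s - 3) / 2) := by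
      rw [← hr]
      exact Real.rpow_le_rpow_of_nonpos ht0 ht.2 (by linarith)
    rw [hk, mul_assoc]
    gcongr
    exact mul_nonneg (Real.exp_pos _).le (le_trans (by positivity) h2)
  have hsub : ∫ t in Ioc (x ^ 2) (2 * x ^ 2), k * x ^ (s - 3) = k * x ^ (s - 1) := by
    have e6 : x ^ (s - 1) = x ^ (s - 3) * x ^ 2 := by
      rw [← Real.rpow_natCast x 2, ← Real.rpow_add hx]; congr 1; push_cast; ring
    rw [setIntegral_const, smul_eq_mul, e6]
    simp only [Measure.real, Real.volume_Ioc]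
    rw [ENNReal.toReal_ofReal (by linarith)]
    ring
  rw [← integral_sub hI hI2, ← hsub]
  calc _ ≤ ∫ t in Ioc (x ^ 2) (2 * x ^ 2), igd s x t - igd s (2 * x) t := by
        refine setIntegral_mono_on continuous_const.integrableOn_Ioc ?_ measurableSet_Ioc hlow
        exact (hI.sub hI2).mono_set (fun t ht => hx2.trans ht.1)
    _ ≤ _ := by
        refine setIntegral_mono_set (hI.sub hI2) ?_ ?_
        · filter_upwards [ae_restrict_mem measurableSet_Ioi] with t ht using hnn t ht
        · exact (show Ioc (x ^ 2) (2 * x ^ 2) ⊆ Ioi 0 from fun t ht => hx2.trans ht.1).eventuallyLE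

/-- Representation of the kernel as a superposition of exponentials. -/
lemma K_mix {s : ℝ} (hs : 0 < s) (hs1 : s < 1) :
    ∃ ν : Measure ℝ, SFinite ν ∧ (∀ᵐ τ ∂ν, 1 ≤ τ) ∧ ∀ x, 0 < x →
      Integrable (fun τ => Real.exp (-(τ * x))) ν ∧
        besselKernel s x = ∫ τ, Real.exp (-(τ * x)) ∂ν := by
  set a : ℝ := (1 - s) / 2 with ha
  have hapos : 0 < a := by rw [ha]; linarith
  have hG := Real.Gamma_pos_of_pos hapos
  have hc := cst_pos hs
  set d1 : ℝ → ENNReal := fun q => ENNReal.ofReal (q ^ (a - 1)) with hd1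
  set d2 : ℝ → ENNReal := fun w => ENNReal.ofReal (cst s / Real.Gamma a * w ^ ((s - 3) / 2)) with hd2
  have hd1m : Measurable d1 := by fun_prop
  have hd2m : Measurable d2 := by fun_prop
  set ν1 := (volume.restrict (Ioi (0 : ℝ))).withDensity d1 with hν1
  set ν2 := (volume.restrict (Ioi (0 : ℝ))).withDensity d2 with hν2
  set T1 : ℝ → ℝ := fun q => |q| with hT1
  set T2 : ℝ → ℝ := fun w => max 1 (w + 1 / (4 * w)) with hT2
  set T : ℝ × ℝ → ℝ := fun p => T1 p.1 + T2 p.2 with hT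
  have hT1m : Measurable T1 := by fun_prop
  have hT2m : Measurable T2 := by fun_prop
  have hTm : Measurable T := by fun_prop
  refine ⟨Measure.map T (ν1.prod ν2), inferInstance, ?_, fun x hx => ?_⟩
  · rw [ae_map_iff hTm.aemeasurable measurableSet_Ici]
    refine ae_of_all _ fun p => ?_
    have h1 : 0 ≤ |p.1| := abs_nonneg _
    have h2 : 1 ≤ max 1 (p.2 + 1 / (4 * p.2)) := le_max_left _ _
    simp only [hT, hT1, hT2]; linarith
  have hT2e : ∀ w, 0 < w → T2 w = w + 1 / (4 * w) := by
    intro w hw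
    apply max_eq_right
    have : w + 1 / (4 * w) - 1 = (2 * w - 1) ^ 2 / (4 * w) := by field_simp; ring
    have : 0 ≤ (2 * w - 1) ^ 2 / (4 * w) := by positivity
    linarith
  -- the two one-dimensional pieces
  have hI1 : ∫ q, Real.exp (-(T1 q * x)) ∂ν1 = x ^ (-a) * Real.Gamma a := by
    rw [hν1, integral_withDensity_eq_integral_toReal_smul hd1m (by simp [hd1])]
    rw [Real.rpow_neg hx.le, ← Real.inv_rpow hx.le, ← one_div,
      ← Real.integral_rpow_mul_exp_neg_mul_Ioi hapos hx]
    refine setIntegral_congr_fun measurableSet_Ioi fun q hq => ?_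
    have hq0 : 0 < q := hq
    simp only [hd1, hT1, smul_eq_mul]
    rw [ENNReal.toReal_ofReal (by positivity), abs_of_pos hq0, mul_comm q x]
  have hJ1 : Integrable (fun q => Real.exp (-(T1 q * x))) ν1 := by
    by_contra h
    rw [integral_undef h] at hI1
    have : 0 < x ^ (-a) * Real.Gamma a := by positivity
    linarith
  have hptw : ∀ w, 0 < w → (d2 w).toReal • Real.exp (-(T2 w * x)) =
      cst s / Real.Gamma a * x ^ ((3 - s) / 2) * igd s x (x * w) := by
    intro w hw
    simp only [hd2, smul_eq_mul]
    rw [ENNReal.toReal_ofReal (by positivity), hT2e w hw]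
    unfold igd
    rw [Real.mul_rpow hx.le hw.le]
    have e1 : x ^ ((3 - s) / 2) * x ^ ((s - 3) / 2) = 1 := by
      rw [← Real.rpow_add hx]; ring_nf; simp
    have e2 : -(x * w) - x ^ 2 / (4 * (x * w)) = -((w + 1 / (4 * w)) * x) := by
      field_simp; ring
    rw [e2]
    linear_combination (-(cst s / Real.Gamma a * w ^ ((s - 3) / 2) *
      Real.exp (-((w + 1 / (4 * w)) * x)))) * e1
  have hI2 : ∫ w, Real.exp (-(T2 w * x)) ∂ν2 =
      cst s / Real.Gamma a * x ^ ((3 - s) / 2) * (x⁻¹ * ∫ t in Ioi (0 : ℝ), igd s x t) := by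
    rw [hν2, integral_withDensity_eq_integral_toReal_smul hd2m (by simp [hd2])]
    rw [setIntegral_congr_fun measurableSet_Ioi (fun w hw => hptw w hw), integral_const_mul,
      integral_comp_mul_left_Ioi _ _ hx, mul_zero, smul_eq_mul]
  have hJ2 : Integrable (fun w => Real.exp (-(T2 w * x))) ν2 := by
    rw [hν2, integrable_withDensity_iff_integrable_smul' hd2m (by simp [hd2])]
    refine IntegrableOn.congr_fun (f := fun w => cst s / Real.Gamma a * x ^ ((3 - s) / 2) *
      igd s x (x * w)) ?_ (fun w hw => (hptw w hw).symm) measurableSet_Ioi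
    refine Integrable.const_mul ?_ _
    have := (integrableOn_Ioi_comp_mul_left_iff (igd s x) 0 hx).2 (by simpa using igd_int hs hx)
    exact this
  have hexp : Measurable (fun τ : ℝ => Real.exp (-(τ * x))) := by fun_prop
  have hsplit : ((fun τ : ℝ => Real.exp (-(τ * x))) ∘ T) =
      fun p : ℝ × ℝ => Real.exp (-(T1 p.1 * x)) * Real.exp (-(T2 p.2 * x)) := by
    funext p
    simp only [hT, Function.comp]
    rw [← Real.exp_add]; congr 1; ring
  constructor
  · rw [integrable_map_measure hexp.aestronglyMeasurable hTm.aemeasurable, hsplit]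
    exact hJ1.mul_prod hJ2
  · rw [integral_map hTm.aemeasurable hexp.aestronglyMeasurable]
    have h5 : (fun p => Real.exp (-(T p * x))) = 
      fun p : ℝ × ℝ => Real.exp (-(T1 p.1 * x)) * Real.exp (-(T2 p.2 * x)) := hsplit
    rw [h5, integral_prod_mul (fun q => Real.exp (-(T1 q * x))) (fun w => Real.exp (-(T2 w * x))),
      hI1, hI2, bessel_eq]
    have e1 : x ^ (-a) * x ^ ((3 - s) / 2) * x⁻¹ = 1 := by
      rw [← Real.rpow_neg_one x, ← Real.rpow_add hx, ← Real.rpow_add hx]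
      have : -a + (3 - s) / 2 + -1 = 0 := by rw [ha]; ring
      rw [this, Real.rpow_zero]
    set I := ∫ t in Ioi (0 : ℝ), igd s x t
    have e2 : cst s / Real.Gamma a * Real.Gamma a = cst s := by field_simp
    linear_combination (-(cst s * I)) * e1 - x ^ (-a) * x ^ ((3 - s) / 2) * x⁻¹ * I * e2

end FKdV

namespace FKdV

lemma ae_ne (a : ℝ) : ∀ᵐ x : ℝ, x ≠ a := by
  simp [ae_iff]

lemma K_int {s : ℝ} (hs : 0 < s) (hs1 : s < 1) : Integrable (besselKernel s) := by
  obtain ⟨C1, hC1, h1⟩ := K_le_inv_sq hs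
  obtain ⟨C2, hC2, h2⟩ := K_le_rpow hs hs1
  have hA : IntegrableOn (besselKernel s) (Ioc 0 1) := by
    have hi : IntervalIntegrable (fun t : ℝ => C2 * t ^ (s - 1)) volume 0 1 :=
      (intervalIntegral.intervalIntegrable_rpow' (by linarith)).const_mul _
    rw [intervalIntegrable_iff_integrableOn_Ioc_of_le zero_le_one] at hi
    refine Integrable.mono' hi (K_meas s).aestronglyMeasurable ?_
    filter_upwards [ae_restrict_mem measurableSet_Ioc] with t ht
    rw [Real.norm_of_nonneg (K_nonneg hs t)]
    exact h2 t ht.1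
  have hB : IntegrableOn (besselKernel s) (Ioi 1) := by
    have hi : IntegrableOn (fun t : ℝ => C1 * t ^ (-2 : ℝ)) (Ioi 1) :=
      (integrableOn_Ioi_rpow_of_lt (by norm_num) one_pos).const_mul _
    refine Integrable.mono' hi (K_meas s).aestronglyMeasurable ?_
    filter_upwards [ae_restrict_mem measurableSet_Ioi] with t ht
    have ht0 : (0 : ℝ) < t := one_pos.trans ht
    rw [Real.norm_of_nonneg (K_nonneg hs t)]
    refine (h1 t ht0).trans_eq ?_
    rw [Real.rpow_neg ht0.le, div_eq_mul_inv]; norm_num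
  have hJ : Integrable ((Ioi (0 : ℝ)).indicator (besselKernel s)) := by
    rw [integrable_indicator_iff measurableSet_Ioi, ← Ioc_union_Ioi_eq_Ioi zero_le_one]
    exact hA.union hB
  refine (hJ.add hJ.comp_neg).mono' (K_meas s).aestronglyMeasurable ?_
  filter_upwards [ae_ne 0] with x hx
  rw [Real.norm_of_nonneg (K_nonneg hs x)]
  rcases lt_or_gt_of_ne hx with h | h
  · have : -x ∈ Ioi (0 : ℝ) := by simpa using h
    have h' : x ∉ Ioi (0 : ℝ) := by simpa using h.le
    simp [this, h', K_even]
  · have : x ∈ Ioi (0 : ℝ) := h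
    have h' : -x ∉ Ioi (0 : ℝ) := by simpa using h.le
    simp [this, h']

lemma K_pos {s : ℝ} (hs : 0 < s) (x : ℝ) (hx : 0 < x) : 0 < besselKernel s x := by
  rw [bessel_eq]
  refine mul_pos (cst_pos hs) ?_
  rw [setIntegral_pos_iff_support_of_nonneg_ae]
  · have : Function.support (igd s x) ∩ Ioi 0 = Ioi 0 := by
      apply inter_eq_right.2
      intro t ht
      have ht : 0 < t := ht
      have : 0 < igd s x t := by unfold igd; positivity
      exact this.ne'
    rw [this]; simp
  · filter_upwards [ae_restrict_mem measurableSet_Ioi] with t ht using igd_nonneg s x t ht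
  · exact igd_int hs hx

lemma K_lt {s : ℝ} (hs : 0 < s) (hs1 : s < 1) {a b : ℝ} (ha : 0 < a) (hab : a < b) :
    besselKernel s b < besselKernel s a := by
  obtain ⟨ν, _, hν, h⟩ := K_mix hs hs1
  have hb := ha.trans hab
  have h1 : besselKernel s b ≤ Real.exp (-(b - a)) * besselKernel s a := by
    rw [(h b hb).2, (h a ha).2, ← integral_const_mul]
    refine integral_mono_ae (h b hb).1 ((h a ha).1.const_mul _) ?_
    filter_upwards [hν] with τ hτ
    rw [← Real.exp_add]
    apply Real.exp_le_exp.2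
    nlinarith
  have h2 := K_pos hs a ha
  have h3 : Real.exp (-(b - a)) < 1 := by
    rw [← Real.exp_zero]; exact Real.exp_lt_exp.2 (by linarith)
  nlinarith

lemma K_anti {s : ℝ} (hs : 0 < s) (hs1 : s < 1) {a b : ℝ} (ha : 0 < a) (hab : a ≤ b) :
    besselKernel s b ≤ besselKernel s a := by
  rcases hab.eq_or_lt with h | h
  · rw [h]
  · exact (K_lt hs hs1 ha h).le

lemma exp_aux {A B : ℝ} (hB : 0 ≤ B) (hAB : B ≤ A) :
    0 ≤ Real.exp A + Real.exp (-A) - Real.exp B - Real.exp (-B) ∧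
    Real.exp A + Real.exp (-A) - Real.exp B - Real.exp (-B) ≤ 2 * A * (A - B) * Real.exp A := by
  have e : Real.exp A + Real.exp (-A) - Real.exp B - Real.exp (-B) =
      (Real.exp A - Real.exp B) * (1 - Real.exp (-(A + B))) := by
    have h1 : Real.exp A * Real.exp (-(A + B)) = Real.exp (-B) := by
      rw [← Real.exp_add]; congr 1; ring
    have h2 : Real.exp B * Real.exp (-(A + B)) = Real.exp (-A) := by
      rw [← Real.exp_add]; congr 1; ring
    linear_combination h1 - h2
  have h1 : 0 ≤ Real.exp A - Real.exp B := sub_nonneg.2 (Real.exp_le_exp.2 hAB)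
  have h2 : 0 ≤ 1 - Real.exp (-(A + B)) := sub_nonneg.2 (Real.exp_le_one_iff.2 (by linarith))
  have h3 : 1 - Real.exp (-(A + B)) ≤ 2 * A := by linarith [Real.add_one_le_exp (-(A + B))]
  have h4 : Real.exp A - Real.exp B ≤ (A - B) * Real.exp A := by
    have h5 := Real.add_one_le_exp (B - A)
    have h6 : Real.exp B = Real.exp A * Real.exp (B - A) := by
      rw [← Real.exp_add]; congr 1; ring
    have := Real.exp_pos A
    rw [h6]; nlinarith
  rw [e]
  refine ⟨mul_nonneg h1 h2, ?_⟩
  calc _ ≤ ((A - B) * Real.exp A) * (2 * A) := mul_le_mul h4 h3 h2 (h1.trans h4)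
    _ = _ := by ring

lemma K_second {s : ℝ} (hs : 0 < s) (hs1 : s < 1) : ∃ C, 0 < C ∧ ∀ x z y, 0 ≤ x → x ≤ z → 0 < z →
    2 * z ≤ y →
    |besselKernel s (y - z) + besselKernel s (y + z) - besselKernel s (y - x)
      - besselKernel s (y + x)| ≤ C * ((z - x) * z * y ^ (s - 3)) := by
  obtain ⟨ν, _, hν, h⟩ := K_mix hs hs1
  obtain ⟨C2, hC2, h2⟩ := K_le_rpow hs hs1
  refine ⟨64 * C2 * (1 / 4) ^ (s - 1), by positivity, fun x z y hx hxz hz hzy => ?_⟩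
  have hy : 0 < y := by linarith
  have p1 := h (y - z) (by linarith)
  have p2 := h (y + z) (by linarith)
  have p3 := h (y - x) (by linarith)
  have p4 := h (y + x) (by linarith)
  have p5 := h (y / 4) (by linarith)
  have p12 : Integrable (fun τ => Real.exp (-(τ * (y - z))) + Real.exp (-(τ * (y + z)))) ν :=
    p1.1.add p2.1
  have p123 : Integrable (fun τ => Real.exp (-(τ * (y - z))) + Real.exp (-(τ * (y + z))) -
      Real.exp (-(τ * (y - x)))) ν := p12.sub p3.1
  rw [p1.2, p2.2, p3.2, p4.2, ← integral_add p1.1 p2.1, ← integral_sub p12 p3.1,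
    ← integral_sub p123 p4.1]
  have hfac : ∀ τ, Real.exp (-(τ * (y - z))) + Real.exp (-(τ * (y + z))) -
      Real.exp (-(τ * (y - x))) - Real.exp (-(τ * (y + x))) =
      Real.exp (-(τ * y)) * (Real.exp (τ * z) + Real.exp (-(τ * z)) - Real.exp (τ * x) -
        Real.exp (-(τ * x))) := by
    intro τ
    simp only [mul_sub, mul_add, ← Real.exp_add]
    ring_nf
  have hz0 : 0 ≤ z - x := by linarith
  have hb : ∀ τ, 1 ≤ τ → |Real.exp (-(τ * (y - z))) + Real.exp (-(τ * (y + z))) -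
      Real.exp (-(τ * (y - x))) - Real.exp (-(τ * (y + x)))| ≤
      64 * ((z - x) * z / y ^ 2) * Real.exp (-(τ * (y / 4))) := by
    intro τ hτ
    have hτ0 : 0 < τ := by linarith
    obtain ⟨q1, q2⟩ := exp_aux (A := τ * z) (B := τ * x) (by positivity) (by gcongr)
    rw [hfac, abs_of_nonneg (mul_nonneg (Real.exp_pos _).le q1)]
    have q3 : τ ^ 2 ≤ 32 / y ^ 2 * Real.exp (τ * y / 4) := by
      have := Real.quadratic_le_exp_of_nonneg (x := τ * y / 4) (by positivity)
      rw [div_mul_eq_mul_div, le_div_iff₀ (by positivity)]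
      have : 0 ≤ τ * y / 4 := by positivity
      nlinarith
    calc _ ≤ Real.exp (-(τ * y)) * (2 * (τ * z) * (τ * z - τ * x) * Real.exp (τ * z)) := by gcongr
      _ = 2 * z * (z - x) * τ ^ 2 * (Real.exp (-(τ * y)) * Real.exp (τ * z)) := by ring
      _ ≤ 2 * z * (z - x) * (32 / y ^ 2 * Real.exp (τ * y / 4)) * Real.exp (-(τ * y / 2)) := by
          rw [← Real.exp_add]
          gcongr
          nlinarith
      _ = 64 * ((z - x) * z / y ^ 2) * (Real.exp (τ * y / 4) * Real.exp (-(τ * y / 2))) := by ring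
      _ = _ := by rw [← Real.exp_add]; congr 2; ring
  calc _ ≤ ∫ τ, 64 * ((z - x) * z / y ^ 2) * Real.exp (-(τ * (y / 4))) ∂ν := by
        rw [← Real.norm_eq_abs]
        refine norm_integral_le_of_norm_le (p5.1.const_mul _) ?_
        filter_upwards [hν] with τ hτ using hb τ hτ
    _ = 64 * ((z - x) * z / y ^ 2) * besselKernel s (y / 4) := by
        rw [integral_const_mul, ← p5.2]
    _ ≤ 64 * ((z - x) * z / y ^ 2) * (C2 * (y / 4) ^ (s - 1)) := by
        gcongr
        exact h2 _ (by linarith)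
    _ = _ := by
        have e1 : (y / 4) ^ (s - 1) = y ^ (s - 1) * (1 / 4) ^ (s - 1) := by
          rw [← Real.mul_rpow hy.le (by norm_num)]; congr 1; ring
        have e2 : y ^ (s - 1) = y ^ (s - 3) * y ^ 2 := by
          rw [← Real.rpow_natCast y 2, ← Real.rpow_add hy]; congr 1; push_cast; ring
        rw [e1, e2]
        field_simp

lemma K_L1 {s : ℝ} (hs : 0 < s) (hs1 : s < 1) : ∃ C, 0 < C ∧ ∀ h, 0 ≤ h →
    ∫ w, |besselKernel s (w + h) - besselKernel s w| ≤ C * h ^ s := by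
  obtain ⟨C2, hC2, h2⟩ := K_le_rpow hs hs1
  have hK := K_int hs hs1
  refine ⟨4 * (C2 * ((1 / 2) ^ s / s)), by positivity, fun h hh => ?_⟩
  have hKs : Integrable (fun w => besselKernel s (|w| + h / 2)) := by
    refine hK.norm.comp_add_right (h / 2) |>.add (hK.norm.comp_sub_left (h/2)) |>.mono'
      ((K_meas s).comp (by fun_prop)).aestronglyMeasurable (ae_of_all _ fun w => ?_)
    simp only [Pi.add_apply]
    rcases abs_cases w with ⟨e, _⟩ | ⟨e, _⟩
    · rw [e]; linarith [norm_nonneg (besselKernel s (h / 2 - w))]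
    · have : -w + h / 2 = h / 2 - w := by ring
      rw [e, this]; linarith [norm_nonneg (besselKernel s (w + h / 2))]
  have hKs2 : Integrable (fun w => besselKernel s (|w + h / 2| + h / 2)) :=
    hKs.comp_add_right (h / 2)
  have hpt : ∀ᵐ w : ℝ, |besselKernel s (w + h) - besselKernel s w| ≤
      besselKernel s (w + h) + besselKernel s w - 2 * besselKernel s (|w + h / 2| + h / 2) := by
    filter_upwards [ae_ne 0, ae_ne (-h)] with w hw hwh
    have hwh' : w + h ≠ 0 := fun e => hwh (by linarith)
    rcases le_total 0 (w + h / 2) with h1 | h1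
    · have h3 : |w| ≤ w + h := abs_le.2 ⟨by linarith, by linarith⟩
      have h4 := K_anti hs hs1 (abs_pos.2 hw) h3
      rw [K_abs] at h4
      have h5 : |w + h / 2| + h / 2 = w + h := by rw [abs_of_nonneg h1]; ring
      rw [h5, abs_of_nonpos (by linarith)]; linarith
    · have h3 : |w + h| ≤ -w := abs_le.2 ⟨by linarith, by linarith⟩
      have h4 := K_anti hs hs1 (abs_pos.2 hwh') h3
      rw [K_abs, K_even] at h4
      have h5 : |w + h / 2| + h / 2 = -w := by rw [abs_of_nonpos h1]; ring
      rw [h5, K_even, abs_of_nonneg (by linarith)]; linarith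
  have hKh := hK.comp_add_right h
  have hmono := integral_mono_ae (hKh.sub hK).abs ((hKh.add hK).sub (hKs2.const_mul 2)) hpt
  refine hmono.trans ?_
  have i1 : ∫ w, besselKernel s (|w + h / 2| + h / 2) =
      2 * ∫ w in Ioi (h / 2), besselKernel s w := by
    rw [integral_add_right_eq_self (fun w => besselKernel s (|w| + h / 2)) (h / 2),
      integral_comp_abs (f := fun w => besselKernel s (w + h / 2))]
    congr 1
    have := (measurePreserving_add_right volume (h / 2)).setIntegral_preimage_emb
      (measurableEmbedding_addRight (h / 2)) (besselKernel s) (Ioi (h / 2))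
    rw [← this]
    simp
  have i2 : ∫ w, besselKernel s w = 2 * ∫ w in Ioi 0, besselKernel s w := by
    rw [← integral_comp_abs (f := besselKernel s)]
    simp_rw [K_abs]
  have hh2 : 0 ≤ h / 2 := by linarith
  have i3 : ∫ w in Ioi 0, besselKernel s w =
      (∫ w in Ioc 0 (h / 2), besselKernel s w) + ∫ w in Ioi (h / 2), besselKernel s w := by
    rw [← setIntegral_union (Ioc_disjoint_Ioi le_rfl) measurableSet_Ioi
      hK.integrableOn hK.integrableOn, Ioc_union_Ioi_eq_Ioi hh2]
  have i4 : ∫ w in Ioc 0 (h / 2), besselKernel s w ≤ C2 * ((1 / 2) ^ s / s * h ^ s) := by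
    have hi : IntervalIntegrable (fun t : ℝ => C2 * t ^ (s - 1)) volume 0 (h / 2) :=
      (intervalIntegral.intervalIntegrable_rpow' (by linarith)).const_mul _
    calc _ ≤ ∫ w in Ioc 0 (h / 2), C2 * w ^ (s - 1) := by
          refine setIntegral_mono_on hK.integrableOn
            ((intervalIntegrable_iff_integrableOn_Ioc_of_le hh2).1 hi) measurableSet_Ioc ?_
          intro t ht
          exact h2 t ht.1
      _ = _ := by
          rw [← intervalIntegral.integral_of_le hh2, intervalIntegral.integral_const_mul,
            integral_rpow (Or.inl (by linarith)), sub_add_cancel, Real.zero_rpow hs.ne',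
            div_eq_mul_one_div h, Real.mul_rpow hh (by norm_num)]
          ring
  have i5 : ∫ w, (besselKernel s (w + h) + besselKernel s w
      - 2 * besselKernel s (|w + h / 2| + h / 2)) =
      4 * ∫ w in Ioc 0 (h / 2), besselKernel s w := by
    have hs2 : Integrable (fun w => besselKernel s (w + h) + besselKernel s w) := hKh.add hK
    rw [integral_sub hs2 (hKs2.const_mul 2), integral_add hKh hK, integral_const_mul,
      integral_add_right_eq_self (besselKernel s) h, i1, i2, i3]
    ring
  calc _ = _ := i5
    _ ≤ _ := by rw [mul_assoc, mul_assoc]; gcongr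

end FKdV

namespace FKdV

/-- The convolution operator. -/
noncomputable def conv (s : ℝ) (u : ℝ → ℝ) (x : ℝ) : ℝ := ∫ y, besselKernel s (x - y) * u y

lemma conv_int {s : ℝ} (hs : 0 < s) (hs1 : s < 1) {u : ℝ → ℝ} (hu : Continuous u) {M : ℝ}
    (hM : ∀ x, |u x| ≤ M) (x : ℝ) : Integrable (fun y => besselKernel s (x - y) * u y) :=
  ((K_int hs hs1).comp_sub_left x).mul_bdd hu.aestronglyMeasurable (ae_of_all _ hM)

lemma conv_half {s : ℝ} (hs : 0 < s) (hs1 : s < 1) {u : ℝ → ℝ} (hu : Continuous u) {M : ℝ}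
    (hM : ∀ x, |u x| ≤ M) (hev : ∀ x, u (-x) = u x) (x : ℝ) :
    conv s u x = ∫ y in Ioi 0, (besselKernel s (x + y) + besselKernel s (x - y)) * u y := by
  have h := conv_int hs hs1 hu hM x
  have h' : Integrable (fun y => besselKernel s (x + y) * u y) := by
    have := h.comp_neg
    simpa [hev] using this
  unfold conv
  rw [← intervalIntegral.integral_Iic_add_Ioi (b := 0) h.integrableOn h.integrableOn]
  have e := integral_comp_neg_Ioi 0 (fun y => besselKernel s (x - y) * u y)
  simp only [neg_zero, sub_neg_eq_add, hev] at e
  rw [← e, ← integral_add h'.integrableOn h.integrableOn]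
  simp only [add_mul]

/-- The key estimate on increments of the convolution for even functions. -/
lemma conv_diff {s : ℝ} (hs : 0 < s) (hs1 : s < 1) : ∃ C, 0 < C ∧ ∀ (u : ℝ → ℝ) (M m ε : ℝ),
    Continuous u → (∀ x, |u x| ≤ M) → (∀ x, u (-x) = u x) → 0 ≤ m → 0 ≤ ε →
    (∀ y, |u y| ≤ m * (|y| ^ s + ε)) → ∀ x z, 0 ≤ x → x ≤ z → 0 < z →
    |conv s u z - conv s u x| ≤ C * m * (z - x) ^ s * (z ^ s + ε) := by
  obtain ⟨C1, hC1, h1⟩ := K_L1 hs hs1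
  obtain ⟨C2, hC2, h2⟩ := K_second hs hs1
  have h1s : 0 < 1 - s := by linarith
  have hK := K_int hs hs1
  refine ⟨2 * C1 + C2 * (1 / (2 * (1 - s))), by positivity, ?_⟩
  intro u M m ε hu hM hev hm hε hb x z hx hxz hz
  set h := z - x with hh
  have hh0 : 0 ≤ h := by rw [hh]; linarith
  rw [conv_half hs hs1 hu hM hev, conv_half hs hs1 hu hM hev]
  have hi : ∀ x, Integrable (fun y => besselKernel s (x + y) + besselKernel s (x - y)) := fun x =>
    (by simpa only [add_comm] using hK.comp_add_right x : Integrable (fun y => besselKernel s (x + y))).add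
      (hK.comp_sub_left x)
  have hiu : ∀ x, Integrable (fun y => (besselKernel s (x + y) + besselKernel s (x - y)) * u y) :=
    fun x => (hi x).mul_bdd hu.aestronglyMeasurable (ae_of_all _ hM)
  rw [← integral_sub (hiu z).integrableOn (hiu x).integrableOn]
  set D : ℝ → ℝ := fun y => |besselKernel s (z + y) - besselKernel s (x + y)| +
    |besselKernel s (z - y) - besselKernel s (x - y)| with hD
  have hf1 : Integrable (fun y => |besselKernel s (z + y) - besselKernel s (x + y)|) := by
    have a := hK.comp_add_right z
    have b := hK.comp_add_right x
    simpa only [add_comm, Pi.sub_apply] using (a.sub b).abs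
  have hf2 : Integrable (fun y => |besselKernel s (z - y) - besselKernel s (x - y)|) :=
    ((hK.comp_sub_left z).sub (hK.comp_sub_left x)).abs
  have hDi : Integrable D := hf1.add hf2
  have hDint : ∫ y in Ioi 0, D y ≤ C1 * h ^ s := by
    have e1 : ∫ y in Ioi 0, D y = ∫ y, |besselKernel s (z - y) - besselKernel s (x - y)| := by
      rw [← intervalIntegral.integral_Iic_add_Ioi (b := 0) hf2.integrableOn hf2.integrableOn]
      have e := integral_comp_neg_Ioi 0 (fun y => |besselKernel s (z - y) - besselKernel s (x - y)|)
      simp only [neg_zero, sub_neg_eq_add] at e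
      rw [← e, ← integral_add hf1.integrableOn hf2.integrableOn]
    rw [e1]
    refine le_trans (le_of_eq ?_) (h1 h hh0)
    rw [← integral_sub_left_eq_self (fun w => |besselKernel s (w + h) - besselKernel s w|) volume x]
    congr 1; funext y
    have : x - y + h = z - y := by rw [hh]; ring
    rw [this]
  set R : ℝ → ℝ := (Ioi (2 * z)).indicator (fun y => C2 * (h * z) * y ^ (2 * s - 3)) with hR
  have h2z : 0 < 2 * z := by linarith
  have hRi : Integrable R := by
    rw [hR, integrable_indicator_iff measurableSet_Ioi]
    exact (integrableOn_Ioi_rpow_of_lt (by linarith) h2z).const_mul _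
  have hRint : ∫ y in Ioi 0, R y ≤ C2 * (1 / (2 * (1 - s))) * (h ^ s * z ^ s) := by
    have e1 : ∫ y in Ioi 0, R y = C2 * (h * z) * ((2 * z) ^ (2 * s - 2) / (2 * (1 - s))) := by
      rw [hR, setIntegral_indicator measurableSet_Ioi]
      have : Ioi (0 : ℝ) ∩ Ioi (2 * z) = Ioi (2 * z) :=
        inter_eq_right.2 (Ioi_subset_Ioi h2z.le)
      rw [this, integral_const_mul, integral_Ioi_rpow_of_lt (by linarith) h2z]
      have e2 : 2 * s - 3 + 1 = 2 * s - 2 := by ring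
      have e3 : 2 * s - 2 = -(2 * (1 - s)) := by ring
      rw [e2, neg_div, ← div_neg, e3, neg_neg]
    rw [e1]
    have e4 : (2 * z) ^ (2 * s - 2) ≤ z ^ (2 * s - 2) :=
      Real.rpow_le_rpow_of_nonpos hz (by linarith) (by linarith)
    have e5 : h * z * z ^ (2 * s - 2) ≤ h ^ s * z ^ s := by
      rcases hh0.eq_or_lt with h0 | h0
      · rw [← h0]; simp [Real.zero_rpow hs.ne']
      have hhz : h ≤ z := by rw [hh]; linarith
      have e6 : h = h ^ s * h ^ (1 - s) := by
        rw [← Real.rpow_add h0]; simp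
      have e7 : z * z ^ (2 * s - 2) = z ^ s * z ^ (s - 1) := by
        have e10 : s + (s - 1) = 1 + (2 * s - 2) := by ring
        rw [← Real.rpow_add hz, e10, Real.rpow_add hz, Real.rpow_one]
      have e8 : h ^ (1 - s) ≤ z ^ (1 - s) := Real.rpow_le_rpow h0.le hhz h1s.le
      have e9 : z ^ (1 - s) * z ^ (s - 1) = 1 := by
        rw [← Real.rpow_add hz]; simp
      calc h * z * z ^ (2 * s - 2) = (h ^ s * h ^ (1 - s)) * (z ^ s * z ^ (s - 1)) := by
            rw [← e6, ← e7]; ring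
        _ ≤ (h ^ s * z ^ (1 - s)) * (z ^ s * z ^ (s - 1)) := by gcongr
        _ = h ^ s * z ^ s * (z ^ (1 - s) * z ^ (s - 1)) := by ring
        _ = _ := by rw [e9, mul_one]
    calc _ ≤ C2 * (h * z) * (z ^ (2 * s - 2) / (2 * (1 - s))) := by gcongr
      _ = C2 * (1 / (2 * (1 - s))) * (h * z * z ^ (2 * s - 2)) := by ring
      _ ≤ _ := by gcongr
  have hpt : ∀ y ∈ Ioi (0 : ℝ), ‖(besselKernel s (z + y) + besselKernel s (z - y)) * u y -
      (besselKernel s (x + y) + besselKernel s (x - y)) * u y‖ ≤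
      m * ((2 * z ^ s + ε) * D y + R y) := by
    intro y hy
    have hy0 : 0 < y := hy
    rw [← sub_mul, norm_mul, Real.norm_eq_abs, Real.norm_eq_abs]
    set E := besselKernel s (z + y) + besselKernel s (z - y) -
      (besselKernel s (x + y) + besselKernel s (x - y)) with hE
    have hED : |E| ≤ D y := by
      have : E = (besselKernel s (z + y) - besselKernel s (x + y)) +
        (besselKernel s (z - y) - besselKernel s (x - y)) := by rw [hE]; ring
      rw [this]; exact abs_add_le _ _
    have hub := hb y
    rw [abs_of_pos hy0] at hub
    have hD0 : 0 ≤ D y := by simp only [hD]; positivity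
    have hzs : 0 < z ^ s := by positivity
    refine (mul_le_mul_of_nonneg_left hub (abs_nonneg E)).trans ?_
    rw [mul_left_comm]
    refine mul_le_mul_of_nonneg_left ?_ hm
    by_cases hyz : 2 * z < y
    · have hRy : R y = C2 * (h * z) * y ^ (2 * s - 3) := by
        rw [hR]; exact indicator_of_mem hyz _
      have hE2 : |E| ≤ C2 * (h * z * y ^ (s - 3)) := by
        have := h2 x z y hx hxz hz hyz.le
        rw [hE]
        rw [← K_even s (z - y), ← K_even s (x - y), add_comm z y, add_comm x y, neg_sub, neg_sub]
        convert this using 2; ring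
      have : |E| * y ^ s ≤ R y := by
        rw [hRy]
        calc _ ≤ C2 * (h * z * y ^ (s - 3)) * y ^ s := by gcongr
          _ = C2 * (h * z) * (y ^ (s - 3) * y ^ s) := by ring
          _ = _ := by rw [← Real.rpow_add hy0]; congr 2; ring
      have : |E| * ε ≤ D y * ε := by gcongr
      nlinarith
    · have hRy : R y = 0 := by
        rw [hR]; exact indicator_of_notMem hyz _
      have hys : y ^ s ≤ 2 * z ^ s := by
        calc y ^ s ≤ (2 * z) ^ s := Real.rpow_le_rpow hy0.le (not_lt.1 hyz) hs.le
          _ = 2 ^ s * z ^ s := Real.mul_rpow (by norm_num) hz.le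
          _ ≤ 2 ^ (1 : ℝ) * z ^ s := by gcongr; norm_num
          _ = _ := by norm_num
      rw [hRy, add_zero, mul_comm]
      gcongr
  have hI1 : Integrable (fun y => (2 * z ^ s + ε) * D y) := hDi.const_mul _
  have hI2 : Integrable (fun y => (2 * z ^ s + ε) * D y + R y) := hI1.add hRi
  rw [← Real.norm_eq_abs]
  have hzs : 0 < z ^ s := by positivity
  have hhs : 0 ≤ h ^ s := by positivity
  calc _ ≤ ∫ y in Ioi 0, m * ((2 * z ^ s + ε) * D y + R y) := by
        refine norm_integral_le_of_norm_le (hI2.const_mul m).integrableOn ?_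
        filter_upwards [ae_restrict_mem measurableSet_Ioi] with y hy using hpt y hy
    _ = m * ((2 * z ^ s + ε) * (∫ y in Ioi 0, D y) + ∫ y in Ioi 0, R y) := by
        rw [integral_const_mul, integral_add hI1.integrableOn hRi.integrableOn, integral_const_mul]
    _ ≤ m * ((2 * z ^ s + ε) * (C1 * h ^ s) + C2 * (1 / (2 * (1 - s))) * (h ^ s * z ^ s)) := by
        gcongr
    _ ≤ m * ((2 * z ^ s + 2 * ε) * (C1 * h ^ s) +
          C2 * (1 / (2 * (1 - s))) * (h ^ s * (z ^ s + ε))) := by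
        gcongr <;> linarith
    _ = _ := by ring

end FKdV

namespace FKdV

lemma exp_int_Ioi {τ : ℝ} (hτ : 0 < τ) {f : ℝ → ℝ} (hf : Continuous f) {M : ℝ}
    (hM : ∀ x, |f x| ≤ M) : IntegrableOn (fun y => Real.exp (-(τ * y)) * f y) (Ioi 0) := by
  have h : IntegrableOn (fun y => Real.exp (-(τ * y))) (Ioi 0) := by
    simpa [neg_mul] using integrableOn_exp_mul_Ioi (a := -τ) (by linarith) 0
  exact Integrable.mul_bdd h hf.aestronglyMeasurable (ae_of_all _ hM)

lemma exp_per_Ioi {τ P : ℝ} (hτ : 0 < τ) (hP : 0 < P) {f : ℝ → ℝ} (hf : Continuous f) {M : ℝ}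
    (hM : ∀ x, |f x| ≤ M) (hper : Function.Periodic f P) :
    (1 - Real.exp (-(τ * P))) * ∫ y in Ioi 0, Real.exp (-(τ * y)) * f y =
      ∫ y in (0 : ℝ)..P, Real.exp (-(τ * y)) * f y := by
  have hi := exp_int_Ioi hτ hf hM
  have e1 : ∫ y in Ioi P, Real.exp (-(τ * y)) * f y =
      Real.exp (-(τ * P)) * ∫ y in Ioi 0, Real.exp (-(τ * y)) * f y := by
    have := (measurePreserving_add_right volume P).setIntegral_preimage_emb
      (measurableEmbedding_addRight P) (fun y => Real.exp (-(τ * y)) * f y) (Ioi P)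
    rw [← this, ← integral_const_mul]
    have e : (fun x => x + P) ⁻¹' Ioi P = Ioi 0 := by simp
    rw [e]
    congr 1; funext y
    rw [hper y, ← mul_assoc, ← Real.exp_add]
    congr 2; ring
  have e2 : ∫ y in Ioi 0, Real.exp (-(τ * y)) * f y =
      (∫ y in (0 : ℝ)..P, Real.exp (-(τ * y)) * f y) + ∫ y in Ioi P, Real.exp (-(τ * y)) * f y := by
    rw [intervalIntegral.integral_of_le hP.le,
      ← setIntegral_union (Ioc_disjoint_Ioi le_rfl) measurableSet_Ioi
      (hi.mono_set Ioc_subset_Ioi_self) (hi.mono_set (Ioi_subset_Ioi hP.le)),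
      Ioc_union_Ioi_eq_Ioi hP.le]
  rw [e1] at e2
  linarith

/-- Periodised exponential kernel, as a function of the distance to the lattice. -/
noncomputable def ek (τ P d : ℝ) : ℝ := Real.exp (-(τ * d)) + Real.exp (-(τ * (P - d)))

lemma ek_sub (τ P a b : ℝ) : ek τ P a - ek τ P b =
    (Real.exp (-(τ * a)) - Real.exp (-(τ * b))) * (1 - Real.exp (-(τ * (P - a - b)))) := by
  unfold ek
  have h1 : Real.exp (-(τ * a)) * Real.exp (-(τ * (P - a - b))) = Real.exp (-(τ * (P - b))) := by
    rw [← Real.exp_add]; congr 1; ring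
  have h2 : Real.exp (-(τ * b)) * Real.exp (-(τ * (P - a - b))) = Real.exp (-(τ * (P - a))) := by
    rw [← Real.exp_add]; congr 1; ring
  linear_combination h1 - h2

lemma ek_anti {τ P a b : ℝ} (hτ : 0 < τ) (hab : a ≤ b) (h : a + b ≤ P) : ek τ P b ≤ ek τ P a := by
  have := ek_sub τ P a b
  have h1 : 0 ≤ Real.exp (-(τ * a)) - Real.exp (-(τ * b)) :=
    sub_nonneg.2 (Real.exp_le_exp.2 (by nlinarith))
  have h2 : 0 ≤ 1 - Real.exp (-(τ * (P - a - b))) :=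
    sub_nonneg.2 (Real.exp_le_one_iff.2 (by nlinarith))
  nlinarith [mul_nonneg h1 h2]

lemma exp_int {τ : ℝ} (hτ : 0 < τ) {f : ℝ → ℝ} (hf : Continuous f) {M : ℝ}
    (hM : ∀ x, |f x| ≤ M) : Integrable (fun y => Real.exp (-(τ * |y|)) * f y) := by
  have hf' : Continuous (fun y => f (-y)) := by fun_prop
  have i1 := exp_int_Ioi hτ hf hM
  have i2 := exp_int_Ioi hτ hf' (fun x => hM (-x))
  have hc : Continuous fun y => Real.exp (-(τ * |y|)) * f y := by fun_prop
  have j1 : IntegrableOn (fun y => Real.exp (-(τ * |y|)) * f y) (Ioi 0) :=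
    i1.congr_fun (fun y hy => by simp only [abs_of_pos (show (0:ℝ) < y from hy)]) measurableSet_Ioi
  have j2 : IntegrableOn (fun y => Real.exp (-(τ * |y|)) * f (-y)) (Ioi 0) :=
    i2.congr_fun (fun y hy => by simp only [abs_of_pos (show (0:ℝ) < y from hy)]) measurableSet_Ioi
  rw [← integrable_indicator_iff measurableSet_Ioi] at j1 j2
  refine (j1.norm.add j2.comp_neg.norm).mono' hc.aestronglyMeasurable ?_
  filter_upwards [ae_ne 0] with y hy
  simp only [Pi.add_apply]
  rcases lt_or_gt_of_ne hy with h | h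
  · have : -y ∈ Ioi (0 : ℝ) := by simpa using h
    rw [indicator_of_mem this]
    simp
  · have : y ∈ Ioi (0 : ℝ) := h
    rw [indicator_of_mem this]
    simp

lemma exp_per {τ P : ℝ} (hτ : 0 < τ) (hP : 0 < P) {f : ℝ → ℝ} (hf : Continuous f) {M : ℝ}
    (hM : ∀ x, |f x| ≤ M) (hper : Function.Periodic f P) :
    (1 - Real.exp (-(τ * P))) * ∫ y, Real.exp (-(τ * |y|)) * f y =
      ∫ y in (0 : ℝ)..P, ek τ P y * f y := by
  have hf' : Continuous (fun y => f (-y)) := by fun_prop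
  have hper' : Function.Periodic (fun y => f (-y)) P := by
    intro y
    show f (-(y + P)) = f (-y)
    rw [neg_add, ← sub_eq_add_neg, hper.sub_eq]
  have a1 := exp_per_Ioi hτ hP hf hM hper
  have a2 := exp_per_Ioi hτ hP hf' (fun x => hM (-x)) hper'
  have i1 := exp_int_Ioi hτ hf hM
  have i2 := exp_int_Ioi hτ hf' (fun x => hM (-x))
  have hInt := exp_int hτ hf hM
  have e1 : ∫ y, Real.exp (-(τ * |y|)) * f y = (∫ y in Ioi 0, Real.exp (-(τ * y)) * f (-y)) +
      ∫ y in Ioi 0, Real.exp (-(τ * y)) * f y := by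
    rw [← intervalIntegral.integral_Iic_add_Ioi (b := 0) hInt.integrableOn hInt.integrableOn]
    have e := integral_comp_neg_Ioi 0 (fun y => Real.exp (-(τ * |y|)) * f y)
    simp only [neg_zero, abs_neg] at e
    rw [← e]
    congr 1
    · exact setIntegral_congr_fun measurableSet_Ioi
        (fun y hy => by simp only [abs_of_pos (show (0:ℝ) < y from hy)])
    · exact setIntegral_congr_fun measurableSet_Ioi
        (fun y hy => by simp only [abs_of_pos (show (0:ℝ) < y from hy)])
  have e2 : ∫ y in (0 : ℝ)..P, Real.exp (-(τ * y)) * f (-y) =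
      ∫ y in (0 : ℝ)..P, Real.exp (-(τ * (P - y))) * f y := by
    have := intervalIntegral.integral_comp_sub_left (a := 0) (b := P)
      (fun y => Real.exp (-(τ * y)) * f (-y)) P
    simp only [sub_self, sub_zero, neg_sub, hper.sub_eq] at this
    rw [← this]
  rw [e1, mul_add, a1, a2, e2, ← intervalIntegral.integral_add]
  · congr 1; funext y; unfold ek; ring
  · exact Continuous.intervalIntegrable (by fun_prop) _ _
  · exact Continuous.intervalIntegrable (by fun_prop) _ _

/-- Distance to the lattice `P ℤ`. -/
noncomputable def dl (P y : ℝ) : ℝ := ‖(y : AddCircle P)‖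

lemma dl_cont (P : ℝ) : Continuous (dl P) := by
  unfold dl; exact continuous_norm.comp (AddCircle.continuous_mk' P)

lemma dl_per (P : ℝ) : Function.Periodic (dl P) P := by
  intro y; simp [dl]

lemma dl_nonneg (P y : ℝ) : 0 ≤ dl P y := norm_nonneg _

lemma dl_le {P : ℝ} (hP : 0 < P) (y : ℝ) : dl P y ≤ P / 2 := by
  have := AddCircle.norm_le_half_period P (x := (y : AddCircle P)) hP.ne'
  rwa [abs_of_pos hP] at this

lemma dl_eq {P : ℝ} (hP : 0 < P) {y : ℝ} (hy : |y| ≤ P / 2) : dl P y = |y| :=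
  (AddCircle.norm_coe_eq_abs_iff P hP.ne').2 (by rwa [abs_of_pos hP])

lemma dl_lip (P x y : ℝ) : |dl P x - dl P y| ≤ |x - y| := by
  unfold dl
  refine (abs_norm_sub_norm_le _ _).trans ?_
  rw [← AddCircle.coe_sub]
  exact QuotientAddGroup.norm_mk_le_norm

lemma u_dl {P : ℝ} {u : ℝ → ℝ} (hper : Function.Periodic u P) (hev : ∀ x, u (-x) = u x) (y : ℝ) :
    u (dl P y) = u y := by
  unfold dl
  rw [AddCircle.norm_eq]
  set n := round (P⁻¹ * y)
  have h : u (y - n * P) = u y := hper.sub_int_mul_eq n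
  rcases abs_choice (y - n * P) with e | e
  · rw [e, h]
  · rw [e, hev, h]

lemma ek_dl {τ P : ℝ} (hP : 0 < P) {y : ℝ} (hy : y ∈ Icc 0 P) : ek τ P (dl P y) = ek τ P y := by
  rcases le_total y (P / 2) with h | h
  · rw [dl_eq hP (by rwa [abs_of_nonneg hy.1]), abs_of_nonneg hy.1]
  · have e : dl P y = P - y := by
      rw [← (dl_per P).sub_eq y, dl_eq hP, abs_of_nonpos (by linarith [hy.2])]
      · ring
      · rw [abs_of_nonpos (by linarith [hy.2])]; linarith
    rw [e]; unfold ek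
    rw [sub_sub_cancel, add_comm]

/-- Lower bound for the increments of the convolution with one exponential. -/
lemma exp_lower {P : ℝ} (hP : 0 < P) {u : ℝ → ℝ} (hu : Continuous u) {M : ℝ}
    (hM : ∀ x, |u x| ≤ M) (hper : Function.Periodic u P) (hev : ∀ x, u (-x) = u x)
    (hmono : MonotoneOn u (Icc 0 (P / 2))) {x α β : ℝ} (hx : 0 < x) (hxα : x < α) (hαβ : α < β)
    (hβ : β ≤ P / 2) (hΔ : u (β - x) ≤ u α) {τ : ℝ} (hτ : 1 ≤ τ) :
    (1 / 2) * (1 - Real.exp (-(P - 2 * β + x))) * (β - α) * (u α - u (β - x)) *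
      (Real.exp (-(τ * (β - x))) - Real.exp (-(τ * β))) ≤
    (∫ y, Real.exp (-(τ * |x - y|)) * u y) - ∫ y, Real.exp (-(τ * |0 - y|)) * u y := by
  have hτ0 : 0 < τ := by linarith
  have hd := dl_cont P
  have hux : Continuous fun y => u (x - y) := by fun_prop
  have e0 : (∫ y, Real.exp (-(τ * |x - y|)) * u y) - ∫ y, Real.exp (-(τ * |0 - y|)) * u y =
      ∫ y, Real.exp (-(τ * |y|)) * (u (x - y) - u y) := by
    have h1 := integral_sub_left_eq_self (fun y => Real.exp (-(τ * |x - y|)) * u y) volume x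
    simp only [sub_sub_cancel] at h1
    rw [← h1, ← integral_sub (exp_int hτ0 hux (fun y => hM (x - y)))]
    · congr 1; funext y; rw [zero_sub, abs_neg]; ring
    · simpa using exp_int hτ0 hu hM
  rw [e0]
  set f : ℝ → ℝ := fun y => u (x - y) - u y with hf_def
  have hf : Continuous f := by fun_prop
  have hfM : ∀ y, |f y| ≤ M + M := fun y => (abs_sub _ _).trans (add_le_add (hM _) (hM _))
  have hfper : Function.Periodic f P := by
    intro y
    show u (x - (y + P)) - u (y + P) = u (x - y) - u y
    rw [hper y, ← sub_sub, hper.sub_eq]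
  have e1 := exp_per hτ0 hP hf hfM hfper
  set E : ℝ → ℝ := fun y => ek τ P (dl P y) with hE_def
  have hE : Continuous E := by
    simp only [hE_def]; unfold ek; fun_prop
  have hEper : Function.Periodic E P := fun y => by simp only [hE_def, dl_per P y]
  have e2 : ∫ y in (0 : ℝ)..P, ek τ P y * f y = ∫ y in (0 : ℝ)..P, E y * f y := by
    refine intervalIntegral.integral_congr fun y hy => ?_
    rw [uIcc_of_le hP.le] at hy
    simp only [hE_def, ek_dl hP hy]
  have e3 : ∫ y in (0 : ℝ)..P, E y * f y = - ∫ y in (0 : ℝ)..P, E (x - y) * f y := by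
    have h1 := intervalIntegral.integral_comp_sub_left (a := 0) (b := P) (fun y => E y * f y) x
    have hp : Function.Periodic (fun y => E y * f y) P := fun y => by
      show E (y + P) * f (y + P) = E y * f y
      rw [hEper, hfper]
    have h2 := hp.intervalIntegral_add_eq 0 (x - P)
    rw [zero_add, sub_add_cancel] at h2
    rw [sub_zero, ← h2] at h1
    rw [← h1, ← intervalIntegral.integral_neg]
    congr 1; funext y
    simp only [hf_def, sub_sub_cancel]; ring
  have e4 : 2 * ∫ y in (0 : ℝ)..P, E y * f y =
      ∫ y in (0 : ℝ)..P, (E y - E (x - y)) * (u (x - y) - u y) := by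
    have : ∫ y in (0 : ℝ)..P, (E y - E (x - y)) * (u (x - y) - u y) =
      (∫ y in (0 : ℝ)..P, E y * f y) - ∫ y in (0 : ℝ)..P, E (x - y) * f y := by
      rw [← intervalIntegral.integral_sub]
      · congr 1; funext y; simp only [hf_def]; ring
      · exact Continuous.intervalIntegrable (by fun_prop) _ _
      · exact Continuous.intervalIntegrable (by fun_prop) _ _
    rw [this]; linarith
  have hmem : ∀ y, dl P y ∈ Icc 0 (P / 2) := fun y => ⟨dl_nonneg P y, dl_le hP y⟩
  have hnn : ∀ y, 0 ≤ (E y - E (x - y)) * (u (x - y) - u y) := by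
    intro y
    rw [← u_dl hper hev y, ← u_dl hper hev (x - y)]
    have m1 := hmem y
    have m2 := hmem (x - y)
    rcases le_total (dl P y) (dl P (x - y)) with h | h
    · exact mul_nonneg (sub_nonneg.2 (ek_anti hτ0 h (by linarith [m1.2, m2.2])))
        (sub_nonneg.2 (hmono m1 m2 h))
    · exact mul_nonneg_of_nonpos_of_nonpos
        (sub_nonpos.2 (ek_anti hτ0 h (by linarith [m1.2, m2.2])))
        (sub_nonpos.2 (hmono m2 m1 h))
  set κ := 1 - Real.exp (-(P - 2 * β + x)) with hκ
  have hκ0 : 0 ≤ κ := sub_nonneg.2 (Real.exp_le_one_iff.2 (by linarith))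
  set D := Real.exp (-(τ * (β - x))) - Real.exp (-(τ * β)) with hD
  have hD0 : 0 ≤ D := sub_nonneg.2 (Real.exp_le_exp.2 (by nlinarith))
  have hlow : ∀ y ∈ Icc α β, κ * (u α - u (β - x)) * D ≤
      (E y - E (x - y)) * (u (x - y) - u y) := by
    intro y hy
    have d1 : dl P y = y := by
      rw [dl_eq hP, abs_of_nonneg] <;> first | linarith [hy.1] | skip
      rw [abs_of_nonneg] <;> linarith [hy.1, hy.2]
    have d2 : dl P (x - y) = y - x := by
      rw [dl_eq hP, abs_of_nonpos] <;> first | linarith [hy.1] | skip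
      rw [abs_of_nonpos] <;> linarith [hy.1, hy.2]
    have hu1 : u α ≤ u y := hmono ⟨by linarith, by linarith⟩
      ⟨by linarith [hy.1], by linarith [hy.2]⟩ hy.1
    have hu2 : u (x - y) ≤ u (β - x) := by
      rw [← hev (x - y), neg_sub]
      exact hmono ⟨by linarith [hy.1], by linarith [hy.2]⟩ ⟨by linarith, by linarith⟩
        (by linarith [hy.2])
    have hk : E (x - y) - E y = (Real.exp (-(τ * (y - x))) - Real.exp (-(τ * y))) *
        (1 - Real.exp (-(τ * (P - (y - x) - y)))) := by
      simp only [hE_def, d1, d2, ek_sub]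
    have k1 : κ ≤ 1 - Real.exp (-(τ * (P - (y - x) - y))) := by
      refine sub_le_sub_left (Real.exp_le_exp.2 ?_) _
      nlinarith [hy.2, mul_nonneg (sub_nonneg.2 hτ) (show 0 ≤ P - (y - x) - y by linarith [hy.2])]
    have k2 : D ≤ Real.exp (-(τ * (y - x))) - Real.exp (-(τ * y)) := by
      have f1 : Real.exp (-(τ * (y - x))) - Real.exp (-(τ * y)) =
          Real.exp (-(τ * y)) * (Real.exp (τ * x) - 1) := by
        rw [mul_sub (Real.exp _), ← Real.exp_add]; congr 1
        · congr 1; ring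
        · ring
      have f2 : D = Real.exp (-(τ * β)) * (Real.exp (τ * x) - 1) := by
        rw [hD, mul_sub (Real.exp _), ← Real.exp_add]; congr 1
        · congr 1; ring
        · ring
      rw [f1, f2]
      refine mul_le_mul_of_nonneg_right (Real.exp_le_exp.2 (by nlinarith [hy.2])) ?_
      exact sub_nonneg.2 (Real.one_le_exp (by positivity))
    have k3 : D * κ ≤ E (x - y) - E y := by
      rw [hk]; exact mul_le_mul k2 k1 hκ0 (hD0.trans k2)
    have k4 : 0 ≤ D * κ := mul_nonneg hD0 hκ0
    have := mul_le_mul k3 (show u α - u (β - x) ≤ u y - u (x - y) by linarith)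
      (sub_nonneg.2 hΔ) (k4.trans k3)
    nlinarith [this]
  have hGc : Continuous fun y => (E y - E (x - y)) * (u (x - y) - u y) := by fun_prop
  have e5 : (β - α) * (κ * (u α - u (β - x)) * D) ≤
      ∫ y in (0 : ℝ)..P, (E y - E (x - y)) * (u (x - y) - u y) := by
    calc (β - α) * (κ * (u α - u (β - x)) * D) = ∫ y in α..β, κ * (u α - u (β - x)) * D := by
          rw [intervalIntegral.integral_const, smul_eq_mul]
      _ ≤ ∫ y in α..β, (E y - E (x - y)) * (u (x - y) - u y) :=
          intervalIntegral.integral_mono_on hαβ.le (by simp) (hGc.intervalIntegrable _ _) hlow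
      _ ≤ _ := intervalIntegral.integral_mono_interval (by linarith) hαβ.le (by linarith)
          (ae_of_all _ hnn) (hGc.intervalIntegrable _ _)
  set J := ∫ y, Real.exp (-(τ * |y|)) * f y
  have hq0 : 0 < 1 - Real.exp (-(τ * P)) :=
    sub_pos.2 (Real.exp_lt_one_iff.2 (by nlinarith [mul_pos hτ0 hP]))
  have hq1 : 1 - Real.exp (-(τ * P)) ≤ 1 := by linarith [Real.exp_pos (-(τ * P))]
  have hA : 0 ≤ (β - α) * (κ * (u α - u (β - x)) * D) :=
    mul_nonneg (by linarith) (mul_nonneg (mul_nonneg hκ0 (by linarith)) hD0)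
  have h7 : (β - α) * (κ * (u α - u (β - x)) * D) ≤ 2 * ((1 - Real.exp (-(τ * P))) * J) := by
    rw [e1, e2, e4]; exact e5
  have hJ : 0 ≤ J := by
    by_contra hneg
    push Not at hneg
    nlinarith [mul_pos hq0 (neg_pos.2 hneg)]
  nlinarith [mul_le_mul_of_nonneg_right hq1 hJ]

end FKdV

namespace FKdV

lemma conv_mix {s : ℝ} (hs : 0 < s) (hs1 : s < 1) {ν : Measure ℝ} [SFinite ν]
    (hν : ∀ x, 0 < x → Integrable (fun τ => Real.exp (-(τ * x))) ν ∧
      besselKernel s x = ∫ τ, Real.exp (-(τ * x)) ∂ν)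
    {u : ℝ → ℝ} (hu : Continuous u) {M : ℝ} (hM : ∀ x, |u x| ≤ M) (x : ℝ) :
    Integrable (fun τ => ∫ y, Real.exp (-(τ * |x - y|)) * u y) ν ∧
    conv s u x = ∫ τ, (∫ y, Real.exp (-(τ * |x - y|)) * u y) ∂ν := by
  have hK : ∀ y, y ≠ x → Integrable (fun τ => Real.exp (-(τ * |x - y|))) ν ∧
      besselKernel s (x - y) = ∫ τ, Real.exp (-(τ * |x - y|)) ∂ν := by
    intro y hy
    have := hν |x - y| (abs_pos.2 (sub_ne_zero.2 hy.symm))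
    rwa [K_abs] at this
  have hc : Continuous (Function.uncurry fun (y τ : ℝ) => Real.exp (-(τ * |x - y|)) * u y) := by
    unfold Function.uncurry; fun_prop
  have hInt : Integrable (Function.uncurry fun (y τ : ℝ) => Real.exp (-(τ * |x - y|)) * u y)
      ((volume : Measure ℝ).prod ν) := by
    rw [integrable_prod_iff hc.aestronglyMeasurable]
    constructor
    · filter_upwards [ae_ne x] with y hy
      exact (hK y hy).1.mul_const (u y)
    · have h := (conv_int hs hs1 hu hM x).norm
      refine h.congr ?_
      filter_upwards [ae_ne x] with y hy
      simp only [Function.uncurry, norm_mul, Real.norm_eq_abs, Real.abs_exp, integral_mul_const]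
      rw [← (hK y hy).2, abs_of_nonneg (K_nonneg hs _)]
  refine ⟨hInt.integral_prod_right, ?_⟩
  rw [← integral_integral_swap hInt]
  unfold conv
  refine integral_congr_ae ?_
  filter_upwards [ae_ne x] with y hy
  rw [integral_mul_const, ← (hK y hy).2]

lemma conv_lower {s : ℝ} (hs : 0 < s) (hs1 : s < 1)
    {P : ℝ} (hP : 0 < P) {u : ℝ → ℝ} (hu : Continuous u) {M : ℝ}
    (hM : ∀ x, |u x| ≤ M) (hper : Function.Periodic u P) (hev : ∀ x, u (-x) = u x)
    (hmono : MonotoneOn u (Icc 0 (P / 2))) {x α β : ℝ} (hx : 0 < x) (hxα : x < α) (hαβ : α < β)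
    (hβ : β ≤ P / 2) (hΔ : u (β - x) ≤ u α) :
    (1 / 2) * (1 - Real.exp (-(P - 2 * β + x))) * (β - α) * (u α - u (β - x)) *
      (besselKernel s (β - x) - besselKernel s β) ≤ conv s u x - conv s u 0 := by
  obtain ⟨ν, hsf, h1, hν⟩ := K_mix hs hs1
  obtain ⟨i1, c1⟩ := conv_mix hs hs1 hν hu hM x
  obtain ⟨i2, c2⟩ := conv_mix hs hs1 hν hu hM 0
  obtain ⟨j1, k1⟩ := hν (β - x) (by linarith)
  obtain ⟨j2, k2⟩ := hν β (by linarith)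
  rw [c1, c2, k1, k2, ← integral_sub i1 i2, ← integral_sub j1 j2, ← integral_const_mul]
  refine integral_mono_ae ((j1.sub j2).const_mul _) (i1.sub i2) ?_
  filter_upwards [h1] with τ hτ
  exact exp_lower hP hu hM hper hev hmono hx hxα hαβ hβ hΔ hτ

end FKdV

namespace FKdV

lemma u_upper {s : ℝ} (hs : 0 < s) (hs1 : s < 1) : ∃ C, 0 < C ∧ ∀ (u : ℝ → ℝ) (M : ℝ),
    Continuous u → (∀ x, |u x| ≤ M) → (∀ x, u (-x) = u x) → (∀ x, 0 ≤ u x) → 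
    (∀ x, u x ^ 2 = 2 * (conv s u x - conv s u 0)) → ∀ x, u x ≤ C * |x| ^ s := by
  obtain ⟨C, hC, h⟩ := conv_diff hs hs1
  refine ⟨2 * C, by positivity, fun u M hu hM hev hnn heq x => ?_⟩
  have habs : ∀ x, u |x| = u x := fun x => by
    rcases abs_choice x with e | e <;> rw [e]
    exact hev x
  have key : ∀ ε, 0 < ε → u x ≤ 2 * C * (|x| ^ s + ε) := by
    intro ε hε
    have hpos : ∀ y : ℝ, 0 < |y| ^ s + ε := fun y => by positivity
    set g : ℝ → ℝ := fun y => u y / (|y| ^ s + ε) with hg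
    have hbdd : BddAbove (range g) := by
      refine ⟨M / ε, ?_⟩
      rintro _ ⟨y, rfl⟩
      refine div_le_div₀ ((abs_nonneg _).trans (hM y)) ((le_abs_self _).trans (hM y)) hε ?_
      have : 0 ≤ |y| ^ s := by positivity
      linarith
    set m := sSup (range g) with hm
    have hgm : ∀ y, g y ≤ m := fun y => le_csSup hbdd ⟨y, rfl⟩
    have hg0 : ∀ y, 0 ≤ g y := fun y => div_nonneg (hnn y) (hpos y).le
    have hm0 : 0 ≤ m := (hg0 0).trans (hgm 0)
    have hum : ∀ y, |u y| ≤ m * (|y| ^ s + ε) := fun y => by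
      rw [abs_of_nonneg (hnn y)]
      exact (div_le_iff₀ (hpos y)).1 (hgm y)
    have hb : ∀ y, g y ^ 2 ≤ 2 * C * m := by
      intro y
      have h1 : u y ^ 2 ≤ 2 * C * m * (|y| ^ s + ε) ^ 2 := by
        rcases eq_or_ne y 0 with rfl | hy
        · rw [heq]; simp only [sub_self, mul_zero]; positivity
        · have hy' : 0 < |y| := abs_pos.2 hy
          have := h u M m ε hu hM hev hm0 hε.le hum 0 |y| le_rfl hy'.le hy'
          have e := heq |y|
          rw [habs] at e
          rw [e, sub_zero] at *
          have q : 0 ≤ |y| ^ s := by positivity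
          calc 2 * (conv s u |y| - conv s u 0) ≤ 2 * (C * m * |y| ^ s * (|y| ^ s + ε)) := by
                linarith [le_abs_self (conv s u |y| - conv s u 0)]
            _ ≤ 2 * (C * m * (|y| ^ s + ε) * (|y| ^ s + ε)) := by gcongr; linarith
            _ = _ := by ring
      simp only [hg, div_pow]
      exact (div_le_iff₀ (by positivity)).2 h1
    have hm2 : m ≤ Real.sqrt (2 * C * m) := by
      refine csSup_le (range_nonempty _) ?_
      rintro _ ⟨y, rfl⟩
      exact Real.le_sqrt_of_sq_le (hb y)
    have hm3 : m ^ 2 ≤ 2 * C * m := (Real.le_sqrt hm0 (by positivity)).1 hm2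
    have hm4 : m ≤ 2 * C := by
      by_contra hlt
      push Not at hlt
      nlinarith
    have := hum x
    rw [abs_of_nonneg (hnn x)] at this
    exact this.trans (mul_le_mul_of_nonneg_right hm4 (hpos x).le)
  refine le_of_forall_pos_le_add fun η hη => ?_
  have := key (η / (2 * C)) (by positivity)
  rwa [mul_add, mul_div_cancel₀ _ (by positivity)] at this

lemma u_pos {s : ℝ} (hs : 0 < s) (hs1 : s < 1)
    {P : ℝ} (hP : 0 < P) {u : ℝ → ℝ} (hu : Continuous u) {M : ℝ}
    (hM : ∀ x, |u x| ≤ M) (hper : Function.Periodic u P) (hev : ∀ x, u (-x) = u x)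
    (hmono : MonotoneOn u (Icc 0 (P / 2))) (hnn : ∀ x, 0 ≤ u x)
    (heq : ∀ x, u x ^ 2 = 2 * (conv s u x - conv s u 0)) (hP2 : u (P / 2) ≠ 0)
    (hsm : ∃ x, 0 < x ∧ x ≤ P / 2 ∧ u x = 0) : False := by
  have hcomp : IsCompact (Icc 0 (P / 2) ∩ u ⁻¹' {0}) :=
    isCompact_Icc.inter_right (isClosed_singleton.preimage hu)
  obtain ⟨x0, hx0, hx0P, hux0⟩ := hsm
  obtain ⟨x, ⟨⟨hx1, hx2⟩, hx3⟩, hmax⟩ := hcomp.exists_isGreatest ⟨x0, ⟨hx0.le, hx0P⟩, hux0⟩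
  have hx3 : u x = 0 := hx3
  have hx : 0 < x := lt_of_lt_of_le hx0 (hmax ⟨⟨hx0.le, hx0P⟩, hux0⟩)
  have hxP : x < P / 2 := lt_of_le_of_ne hx2 (fun e => hP2 (e ▸ hx3))
  set β := min (2 * x) (P / 2) with hβ
  have b1 : β ≤ 2 * x := min_le_left _ _
  have b2 : β ≤ P / 2 := min_le_right _ _
  have b3 : x < β := lt_min (by linarith) hxP
  set α := (x + β) / 2 with hα
  have a1 : x < α := by rw [hα]; linarith
  have a2 : α < β := by rw [hα]; linarith
  have ub : u (β - x) = 0 := by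
    refine le_antisymm ?_ (hnn _)
    rw [← hx3]
    exact hmono ⟨by linarith, by linarith⟩ ⟨hx1, hx2⟩ (by linarith)
  have ua : 0 < u α := by
    refine lt_of_le_of_ne (hnn _) fun e => ?_
    have := hmax ⟨⟨by linarith, by linarith⟩, e.symm⟩
    linarith
  have hl := conv_lower hs hs1 hP hu hM hper hev hmono hx a1 a2 b2 (by rw [ub]; exact ua.le)
  have hz := heq x
  rw [hx3] at hz
  have hz : conv s u x - conv s u 0 = 0 := by linarith
  rw [hz, ub, sub_zero] at hl
  have k := K_lt (s := s) hs hs1 (show 0 < β - x by linarith) (show β - x < β by linarith)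
  have q : 0 < 1 - Real.exp (-(P - 2 * β + x)) :=
    sub_pos.2 (Real.exp_lt_one_iff.2 (by linarith))
  have : 0 < (1 / 2) * (1 - Real.exp (-(P - 2 * β + x))) * (β - α) * u α *
      (besselKernel s (β - x) - besselKernel s β) :=
    mul_pos (mul_pos (mul_pos (mul_pos (by norm_num) q) (by linarith)) ua) (by linarith)
  linarith

lemma u_lower {s : ℝ} (hs : 0 < s) (hs1 : s < 1)
    {P : ℝ} (hP : 0 < P) {u : ℝ → ℝ} (hu : Continuous u) {M : ℝ}
    (hM : ∀ x, |u x| ≤ M) (hper : Function.Periodic u P) (hev : ∀ x, u (-x) = u x)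
    (hmono : MonotoneOn u (Icc 0 (P / 2))) (hnn : ∀ x, 0 ≤ u x)
    (heq : ∀ x, u x ^ 2 = 2 * (conv s u x - conv s u 0))
    (hpos : ∀ x, 0 < x → x ≤ P / 2 → 0 < u x) :
    ∃ b, 0 < b ∧ ∀ x, 0 < x → x ≤ P / 2 → b * x ^ s ≤ u x := by
  obtain ⟨c, hc, hK⟩ := K_diff_ge hs hs1
  set κ := 1 - Real.exp (-(P / 4)) with hκ
  have hκ0 : 0 < κ := sub_pos.2 (Real.exp_lt_one_iff.2 (by linarith))
  set a := κ * c / 2 with ha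
  have ha0 : 0 < a := by positivity
  set δ := min 1 (P / 4) with hδ
  have hδ0 : 0 < δ := lt_min one_pos (by linarith)
  have hδ1 : δ ≤ 1 := min_le_left _ _
  have hδ2 : δ ≤ P / 4 := min_le_right _ _
  set r : ℝ := (3 / 2) ^ s with hr
  have hr1 : 1 < r := Real.one_lt_rpow (by norm_num) hs
  have hstep : ∀ x, 0 < x → x ≤ δ → a * x ^ s * (u (3 / 2 * x) - u x) ≤ u x ^ 2 := by
    intro x hx hxδ
    have hm : u x ≤ u (3 / 2 * x) :=
      hmono ⟨hx.le, by linarith⟩ ⟨by linarith, by linarith⟩ (by linarith)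
    have hl := conv_lower hs hs1 hP hu hM hper hev hmono hx
      (show x < 3 / 2 * x by linarith) (show 3 / 2 * x < 2 * x by linarith) (by linarith)
      (by rw [show 2 * x - x = x by ring]; exact hm)
    rw [show 2 * x - x = x by ring] at hl
    rw [heq]
    have hk := hK x hx (by linarith)
    have hκ' : κ ≤ 1 - Real.exp (-(P - 2 * (2 * x) + x)) :=
      sub_le_sub_left (Real.exp_le_exp.2 (by linarith)) _
    have e : x ^ s = x * x ^ (s - 1) := by
      rw [Real.rpow_sub_one hx.ne']; field_simp
    have hd : 0 ≤ u (3 / 2 * x) - u x := by linarith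
    calc a * x ^ s * (u (3 / 2 * x) - u x)
        = 2 * ((1 / 2) * κ * (2 * x - 3 / 2 * x) * (u (3 / 2 * x) - u x) * (c * x ^ (s - 1))) := by
          rw [e, ha]; ring
      _ ≤ 2 * ((1 / 2) * (1 - Real.exp (-(P - 2 * (2 * x) + x))) * (2 * x - 3 / 2 * x) *
            (u (3 / 2 * x) - u x) * (besselKernel s x - besselKernel s (2 * x))) := by
          have hh : 0 ≤ 2 * x - 3 / 2 * x := by linarith
          have := hκ0.le.trans hκ'
          gcongr
      _ ≤ _ := by linarith
  set b := min (a * (r - 1)) (u δ / (P / 2) ^ s) with hb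
  have hb1 : b ≤ a * (r - 1) := min_le_left _ _
  have hb2 : b ≤ u δ / (P / 2) ^ s := min_le_right _ _
  have hb0 : 0 < b := lt_min (mul_pos ha0 (by linarith))
    (div_pos (hpos δ hδ0 (by linarith)) (by positivity))
  have hbase : ∀ x, δ ≤ x → x ≤ P / 2 → b * x ^ s ≤ u x := by
    intro x h1 h2
    have hx : 0 < x := by linarith
    calc b * x ^ s ≤ u δ / (P / 2) ^ s * (P / 2) ^ s :=
          mul_le_mul hb2 (Real.rpow_le_rpow hx.le h2 hs.le) (by positivity)
            (hb0.le.trans hb2)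
      _ = u δ := div_mul_cancel₀ _ (by positivity)
      _ ≤ u x := hmono ⟨hδ0.le, by linarith⟩ ⟨hx.le, h2⟩ h1
  have hind : ∀ n : ℕ, ∀ x, (2 / 3 : ℝ) ^ n * δ ≤ x → x ≤ P / 2 → b * x ^ s ≤ u x := by
    intro n
    induction n with
    | zero => intro x h1 h2; exact hbase x (by simpa using h1) h2
    | succ n ih =>
      intro x h1 h2
      rcases le_total δ x with h | h
      · exact hbase x h h2
      have hx : 0 < x := lt_of_lt_of_le (by positivity) h1
      have h3 := ih (3 / 2 * x) (by rw [pow_succ] at h1; linarith) (by linarith)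
      rw [Real.mul_rpow (by norm_num) hx.le, ← hr] at h3
      have h4 := hstep x hx h
      by_contra hlt
      push Not at hlt
      have hxs : 0 < x ^ s := by positivity
      have h5 : u x ^ 2 < (b * x ^ s) ^ 2 := pow_lt_pow_left₀ hlt (hnn x) two_ne_zero
      have h6 : a * x ^ s * (b * (r * x ^ s) - b * x ^ s) ≤ u x ^ 2 := by
        refine le_trans ?_ h4
        gcongr
      have h7 : b * (b * (x ^ s) ^ 2) ≤ a * (r - 1) * (b * (x ^ s) ^ 2) :=
        mul_le_mul_of_nonneg_right hb1 (by positivity)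
      nlinarith
  refine ⟨b, hb0, fun x hx hxP => ?_⟩
  obtain ⟨n, hn⟩ := exists_pow_lt_of_lt_one (div_pos hx hδ0) (show (2 / 3 : ℝ) < 1 by norm_num)
  exact hind n x ((lt_div_iff₀ hδ0).1 hn).le hxP

lemma u_holder {s : ℝ} (hs : 0 < s) (hs1 : s < 1)
    {P : ℝ} (hP : 0 < P) {u : ℝ → ℝ} (hu : Continuous u) {M : ℝ}
    (hM : ∀ x, |u x| ≤ M) (hper : Function.Periodic u P) (hev : ∀ x, u (-x) = u x)
    (hmono : MonotoneOn u (Icc 0 (P / 2))) (hnn : ∀ x, 0 ≤ u x)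
    (heq : ∀ x, u x ^ 2 = 2 * (conv s u x - conv s u 0))
    {m b : ℝ} (hm : 0 < m) (hb : 0 < b) (hup : ∀ x, u x ≤ m * |x| ^ s)
    (hlo : ∀ x, 0 < x → x ≤ P / 2 → b * x ^ s ≤ u x) :
    ∃ C, ∀ x y, |u x - u y| ≤ C * |x - y| ^ s := by
  obtain ⟨C, hC, h⟩ := conv_diff hs hs1
  have key : ∀ x z, 0 ≤ x → x ≤ z → z ≤ P / 2 → |u x - u z| ≤ 2 * C * m / b * |x - z| ^ s := by
    intro x z hx hxz hz
    have hxz' := hmono ⟨hx, hxz.trans hz⟩ ⟨hx.trans hxz, hz⟩ hxz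
    rw [abs_sub_comm, abs_of_nonneg (sub_nonneg.2 hxz'), abs_sub_comm,
      abs_of_nonneg (sub_nonneg.2 hxz)]
    rcases (hx.trans hxz).eq_or_lt with h0 | h0
    · have : x = z := by linarith
      subst this
      simp only [sub_self]; positivity
    have h1 := h u M m 0 hu hM hev hm.le le_rfl
      (fun y => by rw [abs_of_nonneg (hnn y), add_zero]; exact hup y) x z hx hxz h0
    have h2 := hlo z h0 hz
    have h3 : (u z - u x) * (u z + u x) = 2 * (conv s u z - conv s u x) := by
      nlinarith [heq x, heq z]
    have hzs : 0 < z ^ s := by positivity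
    rw [add_zero] at h1
    have h4 : (u z - u x) * (b * z ^ s) ≤ 2 * (C * m * (z - x) ^ s * z ^ s) := by
      calc (u z - u x) * (b * z ^ s) ≤ (u z - u x) * (u z + u x) :=
            mul_le_mul_of_nonneg_left (by linarith [hnn x]) (by linarith)
        _ ≤ _ := by rw [h3]; linarith [le_abs_self (conv s u z - conv s u x)]
    have h5 : (u z - u x) * b ≤ 2 * (C * m * (z - x) ^ s) := by
      refine le_of_mul_le_mul_right ?_ hzs
      nlinarith
    calc u z - u x ≤ 2 * (C * m * (z - x) ^ s) / b := (le_div_iff₀ hb).2 h5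
      _ = _ := by ring
  refine ⟨2 * C * m / b, fun x y => ?_⟩
  rw [← u_dl hper hev x, ← u_dl hper hev y]
  have hC' : 0 ≤ 2 * C * m / b := by positivity
  have hl : |dl P x - dl P y| ^ s ≤ |x - y| ^ s :=
    Real.rpow_le_rpow (abs_nonneg _) (dl_lip P x y) hs.le
  refine le_trans ?_ (mul_le_mul_of_nonneg_left hl hC')
  rcases le_total (dl P x) (dl P y) with hh | hh
  · exact key _ _ (dl_nonneg _ _) hh (dl_le hP _)
  · rw [abs_sub_comm, abs_sub_comm (dl P x)]
    exact key _ _ (dl_nonneg _ _) hh (dl_le hP _)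

end FKdV

open FKdV in
theorem fKdV_highest_wave_regularity (s μ P : ℝ) (hs : s ∈ Set.Ioo (0 : ℝ) 1)
    (hP : 0 < P) (φ : ℝ → ℝ) (hφ : IsFKdVSolution s μ φ)
    (heven : ∀ x, φ (-x) = φ x) (hper : Function.Periodic φ P)
    (hnc : ∃ x y, φ x ≠ φ y) (hmono : MonotoneOn φ (Set.Ioo (-(P / 2)) 0))
    (hle : ∀ x, φ x ≤ μ) (hmax : φ 0 = μ) :
    (∃ C, ∀ x y, |φ x - φ y| ≤ C * |x - y| ^ s) ∧
      ∃ c C δ, 0 < c ∧ 0 < C ∧ 0 < δ ∧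
        ∀ x : ℝ, |x| ≤ δ → c * |x| ^ s ≤ μ - φ x ∧ μ - φ x ≤ C * |x| ^ s := by
  obtain ⟨hc, ⟨M₀, hM₀⟩, hE⟩ := hφ
  obtain ⟨hs0, hs1⟩ := hs
  set u : ℝ → ℝ := fun x => μ - φ x with hu_def
  have hu : Continuous u := by fun_prop
  have hM : ∀ x, |u x| ≤ |μ| + M₀ := fun x => (abs_sub _ _).trans (by linarith [hM₀ x])
  have huper : Function.Periodic u P := fun x => by simp only [hu_def, hper x]
  have hev : ∀ x, u (-x) = u x := fun x => by simp only [hu_def, heven x]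
  have hnn : ∀ x, 0 ≤ u x := fun x => sub_nonneg.2 (hle x)
  have h0 : u 0 = 0 := by simp only [hu_def, hmax, sub_self]
  have hmonoI : MonotoneOn u (Ioo 0 (P / 2)) := by
    intro x hx y hy hxy
    have := hmono (a := -y) ⟨by linarith [hy.2], by linarith [hy.1]⟩
      (b := -x) ⟨by linarith [hx.2], by linarith [hx.1]⟩ (by linarith)
    rw [heven, heven] at this
    simp only [hu_def]; linarith
  have humono : MonotoneOn u (Icc 0 (P / 2)) := by
    intro x hx y hy hxy
    rcases hx.1.eq_or_lt with h | h
    · rw [← h, h0]; exact hnn y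
    rcases hxy.eq_or_lt with h' | h'
    · rw [h']
    have hcl := closure_Ioo (show x ≠ P / 2 from (h'.trans_le hy.2).ne)
    refine le_on_closure (f := fun _ => u x) (g := u) (s := Ioo x (P / 2)) (fun z hz => ?_)
      continuousOn_const hu.continuousOn (by rw [hcl]; exact ⟨hxy, hy.2⟩)
    exact hmonoI ⟨h, hz.1.trans hz.2⟩ ⟨h.trans hz.1, hz.2⟩ hz.1.le
  have hconvφ : ∀ x, conv s u x = μ * (∫ y, besselKernel s y) -
      ∫ y, besselKernel s (x - y) * φ y := by
    intro x
    have hi : Integrable fun y => besselKernel s (x - y) := (K_int hs0 hs1).comp_sub_left x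
    have e : ∫ y, besselKernel s (x - y) = ∫ y, besselKernel s y :=
      integral_sub_left_eq_self _ volume x
    rw [← e, ← integral_const_mul, ← integral_sub (hi.const_mul μ) (conv_int hs0 hs1 hc hM₀ x)]
    unfold conv
    congr 1; funext y; simp only [hu_def]; ring
  have heq : ∀ x, u x ^ 2 = 2 * (conv s u x - conv s u 0) := by
    intro x
    have e1 := hE x
    have e2 := hE 0
    rw [hmax] at e2
    rw [hconvφ, hconvφ]
    simp only [hu_def]
    nlinarith
  have hP2 : u (P / 2) ≠ 0 := by
    intro h
    have hz : ∀ x, u x = 0 := by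
      intro x
      refine le_antisymm ?_ (hnn x)
      rw [← u_dl huper hev x, ← h]
      exact humono ⟨dl_nonneg _ _, dl_le hP _⟩ ⟨by linarith, le_rfl⟩ (dl_le hP _)
    obtain ⟨x, y, hxy⟩ := hnc
    have h1 := hz x
    have h2 := hz y
    simp only [hu_def] at h1 h2
    exact hxy (by linarith)
  have hpos : ∀ x, 0 < x → x ≤ P / 2 → 0 < u x := by
    intro x hx hx2
    refine lt_of_le_of_ne (hnn x) fun e => ?_
    exact u_pos hs0 hs1 hP hu hM huper hev humono hnn heq hP2 ⟨x, hx, hx2, e.symm⟩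
  obtain ⟨m, hm, hup⟩ := u_upper hs0 hs1
  have hup := hup u _ hu hM hev hnn heq
  obtain ⟨b, hb, hlo⟩ := u_lower hs0 hs1 hP hu hM huper hev humono hnn heq hpos
  obtain ⟨C, hC⟩ := u_holder hs0 hs1 hP hu hM huper hev humono hnn heq hm hb hup hlo
  refine ⟨⟨C, fun x y => ?_⟩, b, m, P / 2, hb, hm, by linarith, fun x hx => ⟨?_, hup x⟩⟩
  · have := hC x y
    simp only [hu_def] at this
    rwa [show μ - φ x - (μ - φ y) = -(φ x - φ y) by ring, abs_neg] at this
  · show b * |x| ^ s ≤ u x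
    have e : u |x| = u x := by
      rcases abs_choice x with e | e <;> rw [e]
      exact hev x
    rcases eq_or_ne x 0 with rfl | hx0
    · rw [abs_zero, Real.zero_rpow hs0.ne', mul_zero]; exact hnn 0
    · rw [← e]; exact hlo |x| (abs_pos.2 hx0) hx
end

section
/- Let s ∈ (0,1) and P ∈ (0, ∞). Let (φ_n)_{n∈ℕ} be a sequence of even, P-periodic solutions of the steady fKdV equation with corresponding wave speeds (μ_n)_{n∈ℕ}, such that φ_n(x) ≤ μ_n for all x and n, and such that the sequence (μ_n) is bounded. Then there exist a subsequence (φ_{n_k}, μ_{n_k}), a number μ ∈ ℝ, and a bounded continuous function φ : ℝ → ℝ such that μ_{n_k} → μ, φ_{n_k} → φ uniformly on ℝ, and φ is a solution of the steady fKdV equation with wave speed μ. -/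
open MeasureTheory Set

theorem aux_translation (f : ℝ → ℝ) (hf : Integrable f) (x₀ : ℝ) :
    Filter.Tendsto (fun x => ∫ y, |f (x - y) - f (x₀ - y)|) (nhds x₀) (nhds 0) := by
  have hmem : MemLp f 1 := memLp_one_iff_integrable.2 hf
  let g : C(ℝ, C(ℝ, ℝ)) :=
    (ContinuousMap.mk (fun a : ℝ × ℝ => a.1 - a.2) (by fun_prop)).curry
  have hg : ∀ x, MeasurePreserving (g x) volume volume := fun x =>
    Measure.measurePreserving_sub_left volume x
  have hc : Continuous (fun x => Lp.compMeasurePreserving (g x) (hg x) (hmem.toLp f)) :=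
    Continuous.compMeasurePreservingLp (continuous_const) g.continuous hg (by simp)
  have h2 := ((hc.sub (continuous_const (y :=
    Lp.compMeasurePreserving (g x₀) (hg x₀) (hmem.toLp f)))).norm).tendsto x₀
  simp only [Pi.sub_apply] at h2
  rw [sub_self, norm_zero] at h2
  refine h2.congr (fun x => ?_)
  rw [L1.norm_eq_integral_norm]
  apply integral_congr_ae
  have e : ∀ z, Lp.compMeasurePreserving (g z) (hg z) (hmem.toLp f) =ᵐ[volume]
      fun y => f (z - y) := by
    intro z
    refine (Lp.coeFn_compMeasurePreserving _ (hg z)).trans ?_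
    exact (hg z).quasiMeasurePreserving.ae_eq_comp hmem.coeFn_toLp
  filter_upwards [Lp.coeFn_sub (Lp.compMeasurePreserving (g x) (hg x) (hmem.toLp f))
    (Lp.compMeasurePreserving (g x₀) (hg x₀) (hmem.toLp f)), e x, e x₀] with y h1 h2 h3
  rw [h1, Pi.sub_apply, h2, h3, Real.norm_eq_abs]

theorem aux_integrable (s : ℝ) (hs : 0 < s) : Integrable (besselKernel s) := by
  unfold besselKernel
  apply Integrable.const_mul
  have key : Integrable (fun p : ℝ × ℝ =>
      Real.exp (-p.2 - p.1 ^ 2 / (4 * p.2)) * p.2 ^ ((s - 3) / 2))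
      ((volume : Measure ℝ).prod (volume.restrict (Ioi (0:ℝ)))) := by
    rw [integrable_prod_iff' (by
      apply Measurable.aestronglyMeasurable
      fun_prop)]
    have e : ∀ t : ℝ, (fun x : ℝ => Real.exp (-t - x ^ 2 / (4 * t)) * t ^ ((s - 3) / 2))
        = fun x => Real.exp (-(1 / (4 * t)) * x ^ 2) * (Real.exp (-t) * t ^ ((s - 3) / 2)) := by
      intro t
      funext x
      rw [← mul_assoc, ← Real.exp_add]
      congr 2
      ring
    constructor
    · filter_upwards [ae_restrict_mem measurableSet_Ioi] with t ht
      have ht : 0 < t := ht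
      simp only [e]
      exact (integrable_exp_neg_mul_sq (by positivity)).mul_const _
    · have hG := (Real.GammaIntegral_convergent (s := s / 2) (by linarith)).const_mul
        (√(4 * Real.pi))
      refine (integrable_congr ?_).1 hG
      filter_upwards [ae_restrict_mem measurableSet_Ioi] with t ht
      have ht : 0 < t := ht
      have : ∀ x : ℝ, ‖Real.exp (-t - x ^ 2 / (4 * t)) * t ^ ((s - 3) / 2)‖
          = Real.exp (-(1 / (4 * t)) * x ^ 2) * (Real.exp (-t) * t ^ ((s - 3) / 2)) := by
        intro x
        rw [Real.norm_of_nonneg (by positivity)]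
        exact congrFun (e t) x
      simp only [this]
      rw [integral_mul_const, integral_gaussian]
      have h4 : Real.pi / (1 / (4 * t)) = (4 * Real.pi) * t := by field_simp
      rw [h4, Real.sqrt_mul (by positivity : 0 ≤ 4 * Real.pi) t, Real.sqrt_eq_rpow t]
      have h5 : t ^ (s / 2 - 1) = t ^ (1 / 2 : ℝ) * t ^ ((s - 3) / 2) := by
        rw [← Real.rpow_add ht]
        congr 1
        ring
      rw [h5]
      ring
  exact key.integral_prod_left

theorem aux_conv_integrable {K φ : ℝ → ℝ} (hK : Integrable K) (hc : Continuous φ) {B : ℝ}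
    (hB : ∀ x, |φ x| ≤ B) (x : ℝ) : Integrable (fun y => K (x - y) * φ y) :=
  (hK.comp_sub_left x).mul_bdd (c := B) hc.aestronglyMeasurable
    (Filter.Eventually.of_forall (fun y => by simpa using hB y))

theorem aux_conv_bound {K φ : ℝ → ℝ} (hK : Integrable K) {B : ℝ}
    (hB : ∀ x, |φ x| ≤ B) (x : ℝ) : |∫ y, K (x - y) * φ y| ≤ (∫ y, |K y|) * B := by
  have h := norm_integral_le_of_norm_le (f := fun y => K (x - y) * φ y)
    (g := fun y => |K (x - y)| * B) (μ := volume)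
    ((hK.comp_sub_left x).abs.mul_const B)
    (Filter.Eventually.of_forall (fun y => by
      rw [Real.norm_eq_abs, abs_mul]
      exact mul_le_mul_of_nonneg_left (hB y) (abs_nonneg _)))
  rw [integral_mul_const, integral_sub_left_eq_self (fun y => |K y|) volume x] at h
  exact h

theorem aux_conv_diff {K φ : ℝ → ℝ} (hK : Integrable K) (hc : Continuous φ) {B : ℝ}
    (hB : ∀ x, |φ x| ≤ B) (x x' : ℝ) :
    |(∫ y, K (x - y) * φ y) - ∫ y, K (x' - y) * φ y|
      ≤ (∫ y, |K (x - y) - K (x' - y)|) * B := by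
  rw [← integral_sub (aux_conv_integrable hK hc hB x) (aux_conv_integrable hK hc hB x'),
    ← integral_mul_const]
  refine norm_integral_le_of_norm_le (μ := volume)
    (f := fun y => K (x - y) * φ y - K (x' - y) * φ y)
    (g := fun y => |K (x - y) - K (x' - y)| * B)
    (((hK.comp_sub_left x).sub (hK.comp_sub_left x')).abs.mul_const B)
    (Filter.Eventually.of_forall (fun y => ?_))
  rw [Real.norm_eq_abs, ← sub_mul, abs_mul]
  exact mul_le_mul_of_nonneg_left (hB y) (abs_nonneg _)

theorem aux_bound {s μ M : ℝ} {φ : ℝ → ℝ} (hK : Integrable (besselKernel s))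
    (h : IsFKdVSolution s μ φ) (hM : |μ| ≤ M) (x : ℝ) :
    |φ x| ≤ 2 * (M + ∫ y, |besselKernel s y|) := by
  obtain ⟨hc, ⟨B, hB⟩, heq⟩ := h
  have hbdd : BddAbove (range fun x => |φ x|) := ⟨B, by rintro _ ⟨x, rfl⟩; exact hB x⟩
  set S := ⨆ x, |φ x| with hS
  have hle : ∀ x, |φ x| ≤ S := fun x => le_ciSup hbdd x
  have hS0 : 0 ≤ S := (abs_nonneg _).trans (hle 0)
  set C := ∫ y, |besselKernel s y| with hC
  have hC0 : 0 ≤ C := integral_nonneg fun _ => abs_nonneg _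
  have hM0 : 0 ≤ M := (abs_nonneg _).trans hM
  have hsq : ∀ x, |φ x| ^ 2 ≤ 2 * (M + C) * S := by
    intro x
    have h1 := (abs_le.1 (aux_conv_bound hK hle x)).1
    have h2 := heq x
    have h3 : μ * φ x ≤ M * S := by
      refine (le_abs_self _).trans ?_
      rw [abs_mul]
      exact mul_le_mul hM (hle x) (abs_nonneg _) hM0
    rw [sq_abs]
    nlinarith
  have hSle : S ≤ √(2 * (M + C) * S) := ciSup_le fun x => Real.le_sqrt_of_sq_le (hsq x)
  have hS2 : S ^ 2 ≤ 2 * (M + C) * S := by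
    rw [← Real.le_sqrt hS0 (by positivity)]; exact hSle
  refine (hle x).trans ?_
  rcases hS0.eq_or_lt with h0 | h0
  · rw [← h0]; positivity
  · nlinarith

theorem aux_sqrt_diff {s μ B : ℝ} {φ : ℝ → ℝ} (hK : Integrable (besselKernel s))
    (h : IsFKdVSolution s μ φ) (hle : ∀ x, φ x ≤ μ) (hB : ∀ x, |φ x| ≤ B) (x x' : ℝ) :
    |φ x - φ x'| ^ 2 ≤ 2 * ((∫ y, |besselKernel s (x - y) - besselKernel s (x' - y)|) * B) := by
  have h1 := aux_conv_diff hK h.1 hB x x'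
  have e1 := h.2.2 x
  have e2 := h.2.2 x'
  have a := hle x
  have b := hle x'
  rw [abs_le] at h1
  rw [sq_abs]
  rcases le_total (φ x) (φ x') with h3 | h3
  · nlinarith [mul_nonneg (sub_nonneg.2 h3) (sub_nonneg.2 b)]
  · nlinarith [mul_nonneg (sub_nonneg.2 h3) (sub_nonneg.2 a)]

/-- Compactness of bounded families of even, periodic fKdV traveling waves. -/
theorem fKdV_compactness (s P : ℝ) (hs : s ∈ Set.Ioo (0 : ℝ) 1) (hP : 0 < P)
    (φ : ℕ → ℝ → ℝ) (μ : ℕ → ℝ)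
    (hsol : ∀ n, IsFKdVSolution s (μ n) (φ n))
    (heven : ∀ n x, φ n (-x) = φ n x)
    (hper : ∀ n, Function.Periodic (φ n) P)
    (hle : ∀ n x, φ n x ≤ μ n)
    (hbd : ∃ M, ∀ n, |μ n| ≤ M) :
    ∃ (ψ : ℕ → ℕ) (μ₀ : ℝ) (φ₀ : ℝ → ℝ), StrictMono ψ ∧
      Filter.Tendsto (fun k => μ (ψ k)) Filter.atTop (nhds μ₀) ∧
      TendstoUniformly (fun k => φ (ψ k)) φ₀ Filter.atTop ∧
      IsFKdVSolution s μ₀ φ₀ := by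
  obtain ⟨M, hM⟩ := hbd
  have hK := aux_integrable s hs.1
  obtain ⟨B, hB⟩ : ∃ B, ∀ n x, |φ n x| ≤ B :=
    ⟨_, fun n x => aux_bound hK (hsol n) (hM n) x⟩
  -- convergent subsequence of speeds
  obtain ⟨μ₀, -, ψ₁, hψ₁, hμ⟩ := (isCompact_Icc (a := -M) (b := M)).tendsto_subseq
    (x := μ) (fun n => abs_le.1 (hM n))
  -- restrictions to a period
  let F : ℕ → BoundedContinuousFunction (Icc (0:ℝ) P) ℝ := fun n =>
    BoundedContinuousFunction.mkOfCompact
      ⟨fun x => φ (ψ₁ n) x, (hsol (ψ₁ n)).1.comp continuous_subtype_val⟩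
  have hcomp : IsCompact (closure (range F)) := by
    refine BoundedContinuousFunction.arzela_ascoli (Icc (-B) B) isCompact_Icc _ ?_ ?_
    · rintro _ x ⟨n, rfl⟩
      exact abs_le.1 (hB _ _)
    · intro x₀
      rw [Metric.equicontinuousAt_iff_right]
      intro ε hε
      have ht := ((aux_translation _ hK (x₀ : ℝ)).mul_const B).const_mul 2
      simp only [zero_mul, mul_zero] at ht
      have ht2 := (ht.comp (continuous_subtype_val.tendsto x₀)).eventually
        (gt_mem_nhds (show 0 < ε ^ 2 by positivity))
      filter_upwards [ht2] with x hx
      rintro ⟨_, n, rfl⟩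
      have h := aux_sqrt_diff hK (hsol (ψ₁ n)) (hle _) (hB _) (x : ℝ) (x₀ : ℝ)
      have h' := lt_of_pow_lt_pow_left₀ 2 hε.le (h.trans_lt hx)
      rw [dist_comm]
      exact h'
  obtain ⟨g, -, ψ₂, hψ₂, hF⟩ := hcomp.tendsto_subseq
    (x := F) (fun n => subset_closure ⟨n, rfl⟩)
  have hmem : ∀ x, toIcoMod hP 0 x ∈ Icc (0:ℝ) P := fun x =>
    Ico_subset_Icc_self (toIcoMod_mem_Ico' hP x)
  have hval : ∀ n x, φ n x = φ n (toIcoMod hP 0 x) := by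
    intro n x
    exact ((hper n).sub_zsmul_eq (toIcoDiv hP 0 x)).symm
  have hunif : TendstoUniformly (fun k => φ (ψ₁ (ψ₂ k)))
      (fun x => g ⟨toIcoMod hP 0 x, hmem x⟩) Filter.atTop := by
    have h := BoundedContinuousFunction.tendsto_iff_tendstoUniformly.1 hF
    have h2 := h.comp (fun x : ℝ => (⟨toIcoMod hP 0 x, hmem x⟩ : Icc (0:ℝ) P))
    intro u hu
    filter_upwards [h2 u hu] with k hk x
    rw [hval]
    exact hk x
  have hpt := fun x => hunif.tendsto_at x
  have hμ' : Filter.Tendsto (fun k => μ (ψ₁ (ψ₂ k))) Filter.atTop (nhds μ₀) :=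
    hμ.comp hψ₂.tendsto_atTop
  refine ⟨fun k => ψ₁ (ψ₂ k), μ₀, _, hψ₁.comp hψ₂, hμ', hunif, ?_, ⟨B, fun x => ?_⟩, fun x => ?_⟩
  · exact hunif.continuous (Filter.Frequently.of_forall fun k => (hsol _).1)
  · exact le_of_tendsto (hpt x).abs (Filter.Eventually.of_forall fun k => hB _ x)
  · have hint : Filter.Tendsto (fun k => ∫ y, besselKernel s (x - y) * φ (ψ₁ (ψ₂ k)) y)
        Filter.atTop (nhds (∫ y, besselKernel s (x - y) * g ⟨toIcoMod hP 0 y, hmem y⟩)) := by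
      refine tendsto_integral_of_dominated_convergence (fun y => |besselKernel s (x - y)| * B)
        (fun k => (aux_conv_integrable hK (hsol _).1 (hB _) x).aestronglyMeasurable)
        ((hK.comp_sub_left x).abs.mul_const B) (fun k => Filter.Eventually.of_forall fun y => ?_)
        (Filter.Eventually.of_forall fun y => (hpt y).const_mul _)
      rw [Real.norm_eq_abs, abs_mul]
      exact mul_le_mul_of_nonneg_left (hB _ y) (abs_nonneg _)
    refine tendsto_nhds_unique
      (((hμ'.neg.mul (hpt x)).add (((hpt x).pow 2).div_const 2)).add hint) ?_
    exact tendsto_const_nhds.congr fun k => ((hsol _).2.2 x).symm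
end

section
/- Let s ∈ (0,1), μ > 0, κ ∈ ℝ, and let φ be a solution of the steady fDP equation with wave speed μ and constant κ. Then μ² + 8κ ≥ 0, and, setting γ₋ = (μ − √(μ² + 8κ))/4 and γ₊ = (μ + √(μ² + 8κ))/4, either φ ≡ γ₋ on ℝ, or γ₋ ≤ inf_{x∈ℝ} φ(x) ≤ γ₊ ≤ sup_{x∈ℝ} φ(x). -/
open MeasureTheory Set

/-- A solution of the steady fDP equation with wave speed `μ` and constant `κ`:
a bounded continuous function satisfying the equation pointwise. -/
def IsFDPSolution (s μ κ : ℝ) (φ : ℝ → ℝ) : Prop :=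
  Continuous φ ∧ (∃ M, ∀ x, |φ x| ≤ M) ∧
    ∀ x, -μ * φ x + (φ x) ^ 2 / 2 + (3 / 2) * (∫ y, besselKernel s (x - y) * (φ y) ^ 2) = κ

open ProbabilityTheory

/-- heat kernel -/
noncomputable def hk (t y : ℝ) : ℝ := gaussianPDFReal 0 (2 * t).toNNReal y

/-- heat semigroup -/
noncomputable def hP (t : ℝ) (w : ℝ → ℝ) (x : ℝ) : ℝ := ∫ y, hk t y * w (x - y)

/-- subordination density -/
noncomputable def kd (a t : ℝ) : ℝ := (Real.Gamma a)⁻¹ * (Real.exp (-t) * t ^ (a - 1))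

/-- Bessel potential -/
noncomputable def hT (a : ℝ) (w : ℝ → ℝ) (x : ℝ) : ℝ := ∫ t in Ioi (0 : ℝ), kd a t * hP t w x

lemma hk_meas : Measurable (fun p : ℝ × ℝ => hk p.1 p.2) := by
  unfold hk gaussianPDFReal
  fun_prop

lemma hk_nonneg (t y : ℝ) : 0 ≤ hk t y := gaussianPDFReal_nonneg _ _ _

lemma hv_ne {t : ℝ} (ht : 0 < t) : (2 * t).toNNReal ≠ 0 := by
  simp [ht]

lemma hk_int (t : ℝ) : Integrable (hk t) := integrable_gaussianPDFReal _ _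

lemma hk_one {t : ℝ} (ht : 0 < t) : ∫ y, hk t y = 1 := integral_gaussianPDFReal_eq_one _ (hv_ne ht)

lemma hP_eq {t : ℝ} (ht : 0 < t) (w : ℝ → ℝ) (x : ℝ) :
    hP t w x = ∫ y, w (x - y) ∂(gaussianReal 0 (2 * t).toNNReal) := by
  rw [integral_gaussianReal_eq_integral_smul (hv_ne ht)]; rfl

lemma hP_meas {w : ℝ → ℝ} (hw : Measurable w) : Measurable (fun p : ℝ × ℝ => hP p.1 w p.2) := by
  have h : StronglyMeasurable (fun q : (ℝ × ℝ) × ℝ => hk q.1.1 q.2 * w (q.1.2 - q.2)) := by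
    apply Measurable.stronglyMeasurable
    have := hk_meas
    exact (hk_meas.comp (by fun_prop : Measurable (fun q : (ℝ × ℝ) × ℝ => (q.1.1, q.2)))).mul
      (hw.comp (by fun_prop))
  exact (h.integral_prod_right' (ν := (volume : Measure ℝ))).measurable

lemma w_int {w : ℝ → ℝ} (hw : Measurable w) {C : ℝ} (hC : ∀ x, |w x| ≤ C) (x : ℝ)
    (ν : Measure ℝ) [IsFiniteMeasure ν] : Integrable (fun y => w (x - y)) ν :=
  Integrable.of_bound (hw.comp (by fun_prop)).aestronglyMeasurable C
    (Filter.Eventually.of_forall fun y => by simpa using hC (x - y))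

lemma hP_mono {t : ℝ} (ht : 0 < t) {w z : ℝ → ℝ} {x : ℝ}
    (hw : Measurable w) {C : ℝ} (hC : ∀ x, |w x| ≤ C)
    (hz : Integrable (fun y => z (x - y)) (gaussianReal 0 (2 * t).toNNReal))
    (h : ∀ y, z y ≤ w y) : hP t z x ≤ hP t w x := by
  rw [hP_eq ht, hP_eq ht]
  exact integral_mono hz (w_int hw hC x _) fun y => h _

lemma hP_const {t : ℝ} (ht : 0 < t) (c x : ℝ) : hP t (fun _ => c) x = c := by
  rw [hP_eq ht]; simp

lemma hP_sub_const {t : ℝ} (ht : 0 < t) {w : ℝ → ℝ} (hw : Measurable w) {C : ℝ}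
    (hC : ∀ x, |w x| ≤ C) (c x : ℝ) : hP t (fun y => w y - c) x = hP t w x - c := by
  rw [hP_eq ht, hP_eq ht, integral_sub (w_int hw hC x _) (integrable_const _)]; simp

lemma hP_bound {t : ℝ} (ht : 0 < t) {w : ℝ → ℝ} {C : ℝ}
    (hC : ∀ x, |w x| ≤ C) (x : ℝ) : |hP t w x| ≤ C := by
  rw [hP_eq ht]
  have := norm_integral_le_of_norm_le_const (μ := gaussianReal 0 (2 * t).toNNReal)
    (f := fun y => w (x - y)) (C := C)
    (Filter.Eventually.of_forall fun y => by simpa using hC (x - y))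
  simpa using this

lemma hP_comp {t u : ℝ} (ht : 0 < t) (hu : 0 < u) {w : ℝ → ℝ} (hw : Measurable w) {C : ℝ}
    (hC : ∀ x, |w x| ≤ C) (x : ℝ) : hP u (hP t w) x = hP (t + u) w x := by
  rw [hP_eq hu, hP_eq (by positivity : 0 < t + u)]
  have : gaussianReal 0 (2 * (t + u)).toNNReal =
      (gaussianReal 0 (2 * u).toNNReal) ∗ (gaussianReal 0 (2 * t).toNNReal) := by
    rw [gaussianReal_conv_gaussianReal, ← Real.toNNReal_add (by positivity) (by positivity)]
    congr 2 <;> ring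
  rw [this, integral_conv (by rw [← this]; exact w_int hw hC x _)]
  congr 1; ext y
  rw [hP_eq ht]; congr 1; ext z; congr 1; ring

lemma hP_sq {t : ℝ} (ht : 0 < t) (c : ℝ) (x : ℝ) :
    hP t (fun z => c * (x - z) ^ 2) x = 2 * c * t := by
  rw [hP_eq ht]
  have h := variance_fun_id_gaussianReal (μ := 0) (v := (2 * t).toNNReal)
  rw [variance_eq_integral measurable_id'.aemeasurable] at h
  simp only [integral_id_gaussianReal, sub_zero] at h
  simp only [sub_sub_cancel]
  rw [integral_const_mul, h, Real.coe_toNNReal _ (by positivity)]; ring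

lemma sq_int {t : ℝ} (c : ℝ) (x : ℝ) :
    Integrable (fun y => (fun z => c * (x - z) ^ 2) (x - y)) (gaussianReal 0 (2 * t).toNNReal) := by
  simp only [sub_sub_cancel]
  exact ((memLp_id_gaussianReal 2).integrable_sq).const_mul c

lemma kd_int {a : ℝ} (ha : 0 < a) : IntegrableOn (kd a) (Ioi 0) :=
  (Real.GammaIntegral_convergent ha).const_mul _

lemma kd_one {a : ℝ} (ha : 0 < a) : ∫ t in Ioi 0, kd a t = 1 := by
  unfold kd
  rw [integral_const_mul, ← Real.Gamma_eq_integral ha, inv_mul_cancel₀ (Real.Gamma_pos_of_pos ha).ne']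

lemma kd_nonneg {a t : ℝ} (ha : 0 < a) (ht : 0 < t) : 0 ≤ kd a t := by
  have := Real.Gamma_pos_of_pos ha
  unfold kd; positivity

lemma kd_meas (a : ℝ) : Measurable (kd a) := by unfold kd; fun_prop

lemma mul_int {f g : ℝ → ℝ} {S : Set ℝ} (hS : MeasurableSet S) (hf : IntegrableOn f S) (hg : Measurable g) {C : ℝ}
    (hC : ∀ t ∈ S, |g t| ≤ C) : IntegrableOn (fun t => f t * g t) S := by
  refine Integrable.mul_bdd (c := C) hf hg.aestronglyMeasurable ?_
  filter_upwards [ae_restrict_mem hS] with t ht using hC t ht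

lemma hT_int {a : ℝ} (ha : 0 < a) {w : ℝ → ℝ} (hw : Measurable w) {C : ℝ}
    (hC : ∀ x, |w x| ≤ C) (x : ℝ) : IntegrableOn (fun t => kd a t * hP t w x) (Ioi 0) :=
  mul_int measurableSet_Ioi (kd_int ha)
    ((hP_meas hw).comp (by fun_prop : Measurable fun t : ℝ => (t, x))) fun t ht => hP_bound ht hC x

lemma hT_le {a : ℝ} (ha : 0 < a) {w : ℝ → ℝ} (hw : Measurable w) {C : ℝ}
    (hC : ∀ x, |w x| ≤ C) {b : ℝ} (hb : ∀ x, w x ≤ b) (x : ℝ) : hT a w x ≤ b := by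
  calc hT a w x ≤ ∫ t in Ioi 0, kd a t * b := by
        refine setIntegral_mono_on (hT_int ha hw hC x) ((kd_int ha).mul_const _) measurableSet_Ioi ?_
        intro t ht
        refine mul_le_mul_of_nonneg_left ?_ (kd_nonneg ha ht)
        rw [← hP_const ht b x]
        exact hP_mono ht (C := |b|) measurable_const (fun _ => le_rfl) (w_int hw hC x _) hb
    _ = b := by rw [integral_mul_const, kd_one ha, one_mul]

lemma hT_ge {a : ℝ} (ha : 0 < a) {w : ℝ → ℝ} (hw : Measurable w) {C : ℝ}
    (hC : ∀ x, |w x| ≤ C) {b : ℝ} (hb : ∀ x, b ≤ w x) (x : ℝ) : b ≤ hT a w x := by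
  calc b = ∫ t in Ioi 0, kd a t * b := by rw [integral_mul_const, kd_one ha, one_mul]
    _ ≤ hT a w x := by
        refine setIntegral_mono_on ((kd_int ha).mul_const _) (hT_int ha hw hC x) measurableSet_Ioi ?_
        intro t ht
        refine mul_le_mul_of_nonneg_left ?_ (kd_nonneg ha ht)
        rw [← hP_const ht b x]
        exact hP_mono ht hw hC (integrable_const _) hb

lemma hT_sub_const {a : ℝ} (ha : 0 < a) {w : ℝ → ℝ} (hw : Measurable w) {C : ℝ}
    (hC : ∀ x, |w x| ≤ C) (c x : ℝ) : hT a (fun y => w y - c) x = hT a w x - c := by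
  have : hT a (fun y => w y - c) x = ∫ t in Ioi 0, (kd a t * hP t w x - kd a t * c) := by
    refine setIntegral_congr_fun measurableSet_Ioi fun t ht => ?_
    simp only [hP_sub_const ht hw hC]; ring
  rw [this, integral_sub (hT_int ha hw hC x) ((kd_int ha).mul_const _), integral_mul_const,
    kd_one ha, one_mul]; rfl

/-- joint kernel integrable -/
lemma joint_int {a : ℝ} (ha : 0 < a) :
    Integrable (fun p : ℝ × ℝ => kd a p.1 * hk p.1 p.2)
      ((volume.restrict (Ioi 0)).prod volume) := by
  have hm : Measurable (fun p : ℝ × ℝ => kd a p.1 * hk p.1 p.2) :=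
    ((kd_meas a).comp measurable_fst).mul hk_meas
  rw [integrable_prod_iff hm.aestronglyMeasurable]
  refine ⟨Filter.Eventually.of_forall fun t => (hk_int t).const_mul (kd a t), ?_⟩
  refine (kd_int ha).congr ?_
  filter_upwards [ae_restrict_mem measurableSet_Ioi] with t ht
  simp only [norm_mul, integral_const_mul, Real.norm_eq_abs]
  rw [abs_of_nonneg (kd_nonneg ha ht)]
  simp only [abs_of_nonneg (hk_nonneg _ _), hk_one ht, mul_one]

lemma bessel_eq {s : ℝ} (x : ℝ) :
    besselKernel s x = ∫ t in Ioi 0, kd (s / 2) t * hk t x := by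
  unfold besselKernel
  rw [← integral_const_mul]
  refine setIntegral_congr_fun measurableSet_Ioi fun t ht => ?_
  have ht : 0 < t := ht
  simp only [kd, hk, gaussianPDFReal, sub_zero]
  rw [Real.coe_toNNReal _ (by positivity : 0 ≤ 2 * t)]
  have e1 : √(2 * Real.pi * (2 * t)) = 2 * √Real.pi * √t := by
    rw [show 2 * Real.pi * (2 * t) = 2 ^ 2 * (Real.pi * t) by ring, Real.sqrt_mul (by positivity),
      Real.sqrt_sq (by positivity), Real.sqrt_mul Real.pi_pos.le]; ring
  have e2 : t ^ ((s - 3) / 2) = t ^ (s / 2 - 1) / √t := by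
    rw [Real.sqrt_eq_rpow, ← Real.rpow_sub ht]; congr 1; ring
  have e3 : Real.exp (-t - x ^ 2 / (4 * t)) = Real.exp (-t) * Real.exp (-x ^ 2 / (2 * (2 * t))) := by
    rw [← Real.exp_add]; congr 1; ring
  rw [e1, e2, e3]
  simp only [mul_inv, div_eq_mul_inv]; ring

lemma bessel_int {s : ℝ} (hs : 0 < s) : Integrable (besselKernel s) := by
  have := (joint_int (half_pos hs)).integral_prod_right
  refine this.congr (Filter.Eventually.of_forall fun x => ?_)
  simp only [bessel_eq]

lemma bessel_conv {s : ℝ} (hs : 0 < s) {w : ℝ → ℝ} (hw : Measurable w) {C : ℝ}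
    (hC : ∀ x, |w x| ≤ C) (x : ℝ) :
    ∫ y, besselKernel s (x - y) * w y = hT (s / 2) w x := by
  have h1 : ∫ y, besselKernel s (x - y) * w y = ∫ y, besselKernel s y * w (x - y) := by
    rw [← integral_sub_left_eq_self _ volume x]; simp
  rw [h1]
  simp only [bessel_eq, ← integral_mul_const]
  rw [integral_integral_swap]
  · unfold hT hP
    simp only [← integral_const_mul, mul_assoc]
  · have := (joint_int (half_pos hs)).swap
    refine Integrable.mul_bdd (c := C) this ?_ ?_
    · exact (hw.comp (by fun_prop)).aestronglyMeasurable
    · exact Filter.Eventually.of_forall fun y => hC _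

lemma hT_uc {s : ℝ} (hs : 0 < s) {w : ℝ → ℝ} (hw : Measurable w) {C : ℝ} (hC0 : 0 < C)
    (hC : ∀ x, |w x| ≤ C) {e : ℝ} (he : 0 < e) :
    ∃ d > 0, ∀ x y, |y| < d → |hT (s / 2) w (x - y) - hT (s / 2) w x| < e := by
  have hK := bessel_int hs
  let F : ℝ → C(ℝ, ℝ) := fun h => ⟨fun y => y + h, by fun_prop⟩
  have hF : Continuous F := by
    apply ContinuousMap.continuous_of_continuous_uncurry
    simp only [F]; exact (by fun_prop : Continuous fun p : ℝ × ℝ => p.2 + p.1)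
  have hmp : ∀ h, MeasurePreserving (F h) (volume : Measure ℝ) volume := fun h =>
    measurePreserving_add_right volume h
  have hcont := (continuous_const (y := hK.toL1)).compMeasurePreservingLp hF hmp ENNReal.one_ne_top
  have h0 := Metric.continuous_iff.1 hcont 0 (e / C) (by positivity)
  obtain ⟨d, hd, hh⟩ := h0
  refine ⟨d, hd, fun x y hy => ?_⟩
  have h2 := hh (-y) (by simpa using hy)
  rw [L1.dist_eq_integral_dist] at h2
  have h3 : ∫ z, |besselKernel s (z - y) - besselKernel s z| < e / C := by
    refine lt_of_eq_of_lt ?_ h2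
    refine integral_congr_ae ?_
    have e1 := Lp.coeFn_compMeasurePreserving hK.toL1 (hmp (-y))
    have e2 := Lp.coeFn_compMeasurePreserving hK.toL1 (hmp 0)
    have e3 := (hmp (-y)).quasiMeasurePreserving.ae_eq_comp hK.coeFn_toL1
    have e4 := (hmp 0).quasiMeasurePreserving.ae_eq_comp hK.coeFn_toL1
    filter_upwards [e1, e2, e3, e4] with z h1 h2 h3 h4
    rw [h1, h2, h3, h4, Real.dist_eq]
    simp [F, sub_eq_add_neg]
  rw [← bessel_conv hs hw hC, ← bessel_conv hs hw hC]
  have hi : ∀ x, Integrable fun z => besselKernel s (x - z) * w z := fun x =>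
    Integrable.mul_bdd (c := C) (hK.comp_sub_left x) hw.aestronglyMeasurable
      (Filter.Eventually.of_forall fun y => hC _)
  rw [← integral_sub (hi _) (hi _)]
  have hi2 : Integrable fun z => |besselKernel s (z - y) - besselKernel s z| :=
    ((hK.comp_sub_right y).sub hK).abs
  calc |∫ z, (besselKernel s (x - y - z) * w z - besselKernel s (x - z) * w z)|
      ≤ ∫ z, |besselKernel s (x - z - y) - besselKernel s (x - z)| * C := by
        refine (abs_integral_le_integral_abs).trans ?_
        refine integral_mono_of_nonneg (Filter.Eventually.of_forall fun z => abs_nonneg _)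
          ((hi2.comp_sub_left x).mul_const C) (Filter.Eventually.of_forall fun z => ?_)
        simp only
        rw [← sub_mul, abs_mul, sub_right_comm]
        exact mul_le_mul_of_nonneg_left (hC _) (abs_nonneg _)
    _ = (∫ z, |besselKernel s (z - y) - besselKernel s z|) * C := by
        rw [integral_mul_const,
          integral_sub_left_eq_self (fun z => |besselKernel s (z - y) - besselKernel s z|) volume x]
    _ < e := by rwa [lt_div_iff₀ hC0] at h3

lemma hT_bound {a : ℝ} (ha : 0 < a) {w : ℝ → ℝ} (hw : Measurable w) {C : ℝ}
    (hC : ∀ x, |w x| ≤ C) (x : ℝ) : |hT a w x| ≤ C :=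
  abs_le.2 ⟨hT_ge ha hw hC (fun x => (abs_le.1 (hC x)).1) x,
    hT_le ha hw hC (fun x => (abs_le.1 (hC x)).2) x⟩

lemma hT_meas {a : ℝ} {w : ℝ → ℝ} (hw : Measurable w) : Measurable (hT a w) := by
  have h : StronglyMeasurable (fun q : ℝ × ℝ => kd a q.2 * hP q.2 w q.1) := by
    apply Measurable.stronglyMeasurable
    exact ((kd_meas a).comp measurable_snd).mul
      ((hP_meas hw).comp (by fun_prop : Measurable fun q : ℝ × ℝ => (q.2, q.1)))
  exact (h.integral_prod_right' (ν := (volume.restrict (Ioi 0) : Measure ℝ))).measurable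

lemma hP_hT {a : ℝ} (ha : 0 < a) {u : ℝ} (hu : 0 < u) {w : ℝ → ℝ} (hw : Measurable w) {C : ℝ}
    (hC : ∀ x, |w x| ≤ C) (x : ℝ) :
    hP u (hT a w) x = ∫ t in Ioi 0, kd a t * hP (t + u) w x := by
  have h1 : hP u (hT a w) x = ∫ y, ∫ t in Ioi 0, (hk u y * kd a t) * hP t w (x - y) := by
    change (∫ y, hk u y * ∫ t in Ioi 0, kd a t * hP t w (x - y)) = _
    simp only [mul_assoc, integral_const_mul]
  rw [h1, integral_integral_swap]
  · refine setIntegral_congr_fun measurableSet_Ioi fun t ht => ?_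
    rw [← hP_comp ht hu hw hC]
    conv_rhs => rw [hP, ← integral_const_mul]
    congr 1; ext y; ring
  · have hi : Integrable (fun p : ℝ × ℝ => hk u p.1 * kd a p.2)
        (volume.prod (volume.restrict (Ioi 0))) := (hk_int u).mul_prod (kd_int ha)
    refine Integrable.mul_bdd (c := C) hi ?_ ?_
    · exact ((hP_meas hw).comp
        (by fun_prop : Measurable fun q : ℝ × ℝ => (q.2, x - q.1))).aestronglyMeasurable
    · have : ∀ᵐ p : ℝ × ℝ ∂(volume.prod (volume.restrict (Ioi 0))), p.2 ∈ Ioi (0:ℝ) :=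
        Measure.quasiMeasurePreserving_snd.ae (ae_restrict_mem measurableSet_Ioi)
      filter_upwards [this] with p hp
      exact hP_bound hp hC _

/-- truncated Levy density -/
noncomputable def qd (a e u : ℝ) : ℝ := a * e ^ a * u ^ (-1 - a) * Real.exp (-u)

/-- its convolution with `kd` -/
noncomputable def md (a e t : ℝ) : ℝ :=
  (Real.Gamma a)⁻¹ * (Real.exp (-t) * ((max (t - e) 0) ^ a / t))

lemma qd_int0 {a e : ℝ} (ha : 0 < a) (he : 0 < e) :
    IntegrableOn (fun u : ℝ => a * e ^ a * u ^ (-1 - a)) (Ioi e) :=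
  (integrableOn_Ioi_rpow_of_lt (by linarith) he).const_mul _

lemma qd_val {a e c : ℝ} (ha : 0 < a) (hc : 0 < c) :
    ∫ u in Ioi c, a * e ^ a * u ^ (-1 - a) = e ^ a * c ^ (-a) := by
  rw [integral_const_mul, integral_Ioi_rpow_of_lt (by linarith) hc]
  rw [show -1 - a + 1 = -a by ring]
  field_simp

lemma qd_int {a e : ℝ} (ha : 0 < a) (he : 0 < e) : IntegrableOn (qd a e) (Ioi e) := by
  refine mul_int measurableSet_Ioi (qd_int0 ha he) (C := 1) (by fun_prop) fun t ht => ?_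
  have : 0 < t := he.trans ht
  rw [abs_of_nonneg (Real.exp_pos _).le]
  exact Real.exp_le_one_iff.2 (by linarith)

lemma qd_nonneg {a e u : ℝ} (ha : 0 < a) (he : 0 < e) (hu : e < u) : 0 ≤ qd a e u := by
  have : 0 < u := he.trans hu
  unfold qd; positivity

lemma qd_mass {a e : ℝ} (ha : 0 < a) (he : 0 < e) (he1 : e ≤ 1) :
    ∫ u in Ioi e, qd a e u ≤ 1 - e ^ a / 2 := by
  have hpos : ∀ u, e < u → 0 ≤ a * e ^ a * u ^ (-1 - a) := fun u hu => by
    have : 0 < u := he.trans hu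
    positivity
  have hi := qd_int0 ha he
  have hi1 : IntegrableOn (fun u : ℝ => a * e ^ a * u ^ (-1 - a)) (Ioi 1) :=
    hi.mono_set (Ioi_subset_Ioi he1)
  have hi2 : Integrable ((Ioi (1:ℝ)).indicator (fun u : ℝ => a * e ^ a * u ^ (-1 - a)))
      (volume.restrict (Ioi e)) := hi.indicator measurableSet_Ioi
  calc ∫ u in Ioi e, qd a e u
      ≤ ∫ u in Ioi e, (a * e ^ a * u ^ (-1 - a) -
          (Ioi (1:ℝ)).indicator (fun u : ℝ => a * e ^ a * u ^ (-1 - a)) u * (1 / 2)) := by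
        refine setIntegral_mono_on (qd_int ha he) (hi.sub (hi2.mul_const _)) measurableSet_Ioi ?_
        intro u hu
        have hu : e < u := hu
        have h0 := hpos u hu
        have hu0 : 0 < u := he.trans hu
        unfold qd
        by_cases h : 1 < u
        · rw [indicator_of_mem (show u ∈ Ioi 1 from h)]
          have : Real.exp (-u) ≤ 1 / 2 := by
            have h2 : Real.exp (-u) ≤ Real.exp (-1) := Real.exp_le_exp.2 (by linarith)
            have := Real.exp_neg_one_lt_d9
            linarith
          nlinarith
        · rw [indicator_of_notMem (show u ∉ Ioi 1 from h)]
          have : Real.exp (-u) ≤ 1 := Real.exp_le_one_iff.2 (by linarith)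
          nlinarith
    _ = 1 - e ^ a / 2 := by
        rw [integral_sub hi (hi2.mul_const _), integral_mul_const,
          setIntegral_indicator measurableSet_Ioi, Ioi_inter_Ioi, sup_eq_right.2 he1,
          qd_val ha he, qd_val ha one_pos, ← Real.rpow_add he]
        simp; ring

lemma beta_int {a e t : ℝ} (ha : 0 < a) (he : 0 < e) (het : e < t) :
    ∫ u in Ioo e t, a * u ^ (-1 - a) * (t - u) ^ (a - 1) = t⁻¹ * ((t - e) / e) ^ a := by
  have ht : 0 < t := he.trans het
  rw [← integral_Ioc_eq_integral_Ioo, ← intervalIntegral.integral_of_le het.le]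
  have hc : ContinuousOn (fun u => -(t⁻¹ * ((t - u) / u) ^ a)) (Icc e t) := by
    refine (ContinuousOn.mul continuousOn_const (ContinuousOn.rpow_const ?_ ?_)).neg
    · refine ContinuousOn.div (by fun_prop) (by fun_prop) fun u hu => (he.trans_le hu.1).ne'
    · intro u hu; right; exact ha.le
  have hd : ∀ u ∈ Ioo e t, HasDerivAt (fun u => -(t⁻¹ * ((t - u) / u) ^ a))
      (a * u ^ (-1 - a) * (t - u) ^ (a - 1)) u := by
    intro u hu
    have hu0 : 0 < u := he.trans hu.1
    have htu : 0 < t - u := by linarith [hu.2]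
    have h1 : HasDerivAt (fun u => (t - u) / u) (((-1) * u - (t - u) * 1) / u ^ 2) u :=
      ((hasDerivAt_id u).const_sub t).div (hasDerivAt_id u) hu0.ne'
    have h2 := ((h1.rpow_const (p := a) (Or.inl (by positivity))).const_mul t⁻¹).neg
    refine h2.congr_deriv ?_
    rw [Real.div_rpow htu.le hu0.le, show -1 - a = -(a - 1) - 2 by ring,
      Real.rpow_sub hu0 (-(a-1)) 2, Real.rpow_neg hu0.le, Real.rpow_two]
    have : 0 < u ^ (a - 1) := by positivity
    field_simp
    ring
  have hp : ∀ u ∈ Ioo e t, 0 ≤ a * u ^ (-1 - a) * (t - u) ^ (a - 1) := by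
    intro u hu
    have hu0 : 0 < u := he.trans hu.1
    have htu : 0 < t - u := by linarith [hu.2]
    positivity
  have hint := intervalIntegral.integrableOn_deriv_of_nonneg hc hd hp
  rw [intervalIntegral.integral_eq_sub_of_hasDerivAt_of_le het.le hc hd
    ((intervalIntegrable_iff_integrableOn_Ioc_of_le het.le).2 hint)]
  simp [Real.zero_rpow ha.ne']

lemma conv_val {a e t : ℝ} (ha : 0 < a) (he : 0 < e) (ht : 0 < t) :
    ∫ u, (Ioi e).indicator (qd a e) u * (Ioi 0).indicator (kd a) (t - u) = md a e t := by
  have h1 : (fun u => (Ioi e).indicator (qd a e) u * (Ioi 0).indicator (kd a) (t - u)) =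
      (Ioo e t).indicator (fun u => qd a e u * kd a (t - u)) := by
    ext u
    by_cases h1 : e < u
    · by_cases h2 : u < t
      · rw [indicator_of_mem (show u ∈ Ioi e from h1),
          indicator_of_mem (show t - u ∈ Ioi 0 from sub_pos.2 h2),
          indicator_of_mem (show u ∈ Ioo e t from ⟨h1, h2⟩)]
      · rw [indicator_of_notMem (show t - u ∉ Ioi 0 from fun h => h2 (sub_pos.1 h)),
          indicator_of_notMem (show u ∉ Ioo e t from fun h => h2 h.2), mul_zero]
    · rw [indicator_of_notMem (show u ∉ Ioi e from h1),
          indicator_of_notMem (show u ∉ Ioo e t from fun h => h1 h.1), zero_mul]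
  rw [h1, integral_indicator measurableSet_Ioo]
  by_cases het : e < t
  · have : ∫ u in Ioo e t, qd a e u * kd a (t - u) =
        ∫ u in Ioo e t, ((Real.Gamma a)⁻¹ * Real.exp (-t) * e ^ a) *
          (a * u ^ (-1 - a) * (t - u) ^ (a - 1)) := by
      refine setIntegral_congr_fun measurableSet_Ioo fun u hu => ?_
      simp only [qd, kd]
      have : Real.exp (-t) = Real.exp (-u) * Real.exp (-(t - u)) := by
        rw [← Real.exp_add]; congr 1; ring
      rw [this]; ring
    rw [this, integral_const_mul, beta_int ha he het, md, max_eq_left (by linarith),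
      Real.div_rpow (by linarith) he.le]
    have : 0 < e ^ a := by positivity
    field_simp
  · rw [Ioo_eq_empty het, md, max_eq_right (by linarith), Real.zero_rpow ha.ne']; simp

lemma md_le {a e t : ℝ} (ha : 0 < a) (he : 0 < e) (ht : 0 < t) : md a e t ≤ kd a t := by
  have := Real.Gamma_pos_of_pos ha
  unfold md kd
  rw [Real.rpow_sub ht, Real.rpow_one]
  have : (max (t - e) 0) ^ a ≤ t ^ a :=
    Real.rpow_le_rpow (le_max_right _ _) (max_le (by linarith) ht.le) ha.le
  gcongr

lemma md_nonneg {a e t : ℝ} (ha : 0 < a) (ht : 0 < t) : 0 ≤ md a e t := by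
  have := Real.Gamma_pos_of_pos ha
  have : 0 ≤ max (t - e) 0 := le_max_right _ _
  unfold md; positivity

lemma md_int {a e : ℝ} (ha : 0 < a) (he : 0 < e) : IntegrableOn (md a e) (Ioi 0) := by
  refine Integrable.mono' (kd_int ha) ?_ ?_
  · exact (by unfold md; fun_prop : Measurable (md a e)).aestronglyMeasurable
  · filter_upwards [ae_restrict_mem measurableSet_Ioi] with t ht
    rw [Real.norm_of_nonneg (md_nonneg ha ht)]
    exact md_le ha he ht

lemma md_moment {a e : ℝ} (ha : 0 < a) (he : 0 < e) :
    IntegrableOn (fun t => (kd a t - md a e t) * t) (Ioi 0) ∧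
    ∫ t in Ioi 0, (kd a t - md a e t) * t ≤ a * e := by
  have hG := Real.Gamma_pos_of_pos ha
  have h1 : IntegrableOn (fun t : ℝ => Real.exp (-t) * t ^ a) (Ioi 0) := by
    simpa using Real.GammaIntegral_convergent (s := a + 1) (by linarith)
  have v1 : ∫ t in Ioi 0, Real.exp (-t) * t ^ a = a * Real.Gamma a := by
    rw [← Real.Gamma_add_one ha.ne', Real.Gamma_eq_integral (by linarith)]; simp
  let g : ℝ → ℝ := (Ioi 0).indicator fun t => Real.exp (-t) * t ^ a
  have hg : Integrable g := h1.integrable_indicator measurableSet_Ioi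
  have hgv : ∫ t, g t = a * Real.Gamma a := by
    rw [← v1, integral_indicator measurableSet_Ioi]
  have key : ∀ t : ℝ, g (t - e) * Real.exp (-e) = Real.exp (-t) * (max (t - e) 0) ^ a := by
    intro t
    by_cases h : 0 < t - e
    · simp only [g]
      rw [indicator_of_mem (show t - e ∈ Ioi 0 from h), max_eq_left h.le, mul_right_comm,
        ← Real.exp_add]
      congr 2; ring
    · simp only [g]
      rw [indicator_of_notMem (show t - e ∉ Ioi 0 from h), max_eq_right (not_lt.1 h),
        Real.zero_rpow ha.ne']; simp
  have hg2 : Integrable (fun t => g (t - e) * Real.exp (-e)) := (hg.comp_sub_right e).mul_const _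
  have v2 : ∫ t in Ioi 0, g (t - e) * Real.exp (-e) = a * Real.Gamma a * Real.exp (-e) := by
    rw [setIntegral_eq_integral_of_forall_compl_eq_zero, integral_mul_const,
      integral_sub_right_eq_self g e, hgv]
    intro t ht
    have ht : t ≤ 0 := not_lt.1 ht
    simp only [g]
    rw [indicator_of_notMem (show t - e ∉ Ioi 0 from fun h => by
      have : 0 < t - e := h
      linarith), zero_mul]
  have hEq : EqOn (fun t => (Real.Gamma a)⁻¹ * (Real.exp (-t) * t ^ a - g (t - e) * Real.exp (-e)))
      (fun t => (kd a t - md a e t) * t) (Ioi 0) := by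
    intro t ht
    have ht : 0 < t := ht
    simp only [key, kd, md]
    rw [Real.rpow_sub ht, Real.rpow_one]
    field_simp
  have hI : IntegrableOn (fun t => (Real.Gamma a)⁻¹ *
      (Real.exp (-t) * t ^ a - g (t - e) * Real.exp (-e))) (Ioi 0) :=
    (h1.sub hg2.integrableOn).const_mul _
  refine ⟨hI.congr_fun hEq measurableSet_Ioi, ?_⟩
  rw [← setIntegral_congr_fun measurableSet_Ioi hEq, integral_const_mul,
    integral_sub h1 hg2.integrableOn, v1, v2]
  have : 1 - Real.exp (-e) ≤ e := by linarith [Real.add_one_le_exp (-e)]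
  calc (Real.Gamma a)⁻¹ * (a * Real.Gamma a - a * Real.Gamma a * Real.exp (-e))
      = a * (1 - Real.exp (-e)) := by field_simp
    _ ≤ a * e := by gcongr

lemma conv_id {a e : ℝ} (ha : 0 < a) (he : 0 < e) {w : ℝ → ℝ} (hw : Measurable w) {C : ℝ}
    (hC : ∀ x, |w x| ≤ C) (x : ℝ) :
    ∫ t in Ioi 0, md a e t * hP t w x = ∫ u in Ioi e, qd a e u * hP u (hT a w) x := by
  have hC0 : 0 ≤ C := (abs_nonneg _).trans (hC 0)
  let q0 := (Ioi e).indicator (qd a e)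
  let k0 := (Ioi 0).indicator (kd a)
  let F : ℝ → ℝ := (Ioi 0).indicator fun t => hP t w x
  have hq : Integrable q0 := (qd_int ha he).integrable_indicator measurableSet_Ioi
  have hk : Integrable k0 := (kd_int ha).integrable_indicator measurableSet_Ioi
  have hFm : Measurable F := Measurable.indicator
    ((hP_meas hw).comp (by fun_prop : Measurable fun t : ℝ => (t, x))) measurableSet_Ioi
  have hFb : ∀ t, |F t| ≤ C := by
    intro t
    by_cases h : t ∈ Ioi (0:ℝ)
    · simp only [F]; rw [indicator_of_mem h]; exact hP_bound h hC x
    · simp only [F]; rw [indicator_of_notMem h]; simpa using hC0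
  have hL : ∫ t in Ioi 0, md a e t * hP t w x = ∫ t, ∫ u, (q0 u * k0 (t - u)) * F t := by
    rw [← integral_indicator measurableSet_Ioi]
    congr 1; ext t
    rw [integral_mul_const]
    by_cases h : t ∈ Ioi (0:ℝ)
    · rw [indicator_of_mem h, conv_val ha he h]; simp only [F]; rw [indicator_of_mem h]
    · rw [indicator_of_notMem h]; simp only [F]; rw [indicator_of_notMem h, mul_zero]
  rw [hL, integral_integral_swap]
  · rw [← integral_indicator measurableSet_Ioi]
    congr 1; ext u
    by_cases h : u ∈ Ioi e
    · have hu : 0 < u := he.trans h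
      rw [indicator_of_mem h, hP_hT ha hu hw hC, ← integral_add_right_eq_self _ u]
      simp only [q0, add_sub_cancel_right]
      rw [indicator_of_mem h, ← integral_indicator measurableSet_Ioi, ← integral_const_mul]
      congr 1; ext t
      by_cases h2 : t ∈ Ioi (0:ℝ)
      · have : t + u ∈ Ioi (0:ℝ) := add_pos h2 hu
        simp only [k0, F]
        rw [indicator_of_mem h2, indicator_of_mem this, indicator_of_mem h2, mul_assoc]
      · simp only [k0]
        rw [indicator_of_notMem h2, indicator_of_notMem h2]; simp
    · rw [indicator_of_notMem h]
      simp only [q0]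
      rw [indicator_of_notMem h]; simp
  · have := hq.convolution_integrand (ContinuousLinearMap.mul ℝ ℝ) hk
    refine Integrable.mul_bdd (c := C) this ?_ ?_
    · exact (hFm.comp measurable_fst).aestronglyMeasurable
    · exact Filter.Eventually.of_forall fun p => hFb _

/-- Lower bound at a point near which `w ≥ 0`. -/
lemma key_bound {a e : ℝ} (ha : 0 < a) (he : 0 < e) (he1 : e ≤ 1) {w : ℝ → ℝ} (hw : Measurable w)
    {C : ℝ} (hC : ∀ x, |w x| ≤ C) {V c : ℝ} (hV : 0 ≤ V) (hv : ∀ x, -V ≤ hT a w x)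
    (hc : 0 ≤ c) (x : ℝ) (hx : ∀ z, -c * (x - z) ^ 2 ≤ w z) :
    -V * (1 - e ^ a / 2) - 2 * c * (a * e) ≤ hT a w x := by
  have hPm : Measurable fun t => hP t w x :=
    (hP_meas hw).comp (by fun_prop : Measurable fun t : ℝ => (t, x))
  have hi1 := hT_int ha hw hC x
  have hi2 : IntegrableOn (fun t => md a e t * hP t w x) (Ioi 0) :=
    mul_int measurableSet_Ioi (md_int ha he) hPm fun t ht => hP_bound ht hC x
  have hm := hT_meas (a := a) hw
  have hb := hT_bound ha hw hC
  have hsplit : hT a w x = (∫ t in Ioi 0, (kd a t * hP t w x - md a e t * hP t w x)) +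
      ∫ u in Ioi e, qd a e u * hP u (hT a w) x := by
    rw [integral_sub hi1 hi2, ← conv_id ha he hw hC]; unfold hT; ring
  rw [hsplit]
  have hA : -V * (1 - e ^ a / 2) ≤ ∫ u in Ioi e, qd a e u * hP u (hT a w) x := by
    calc -V * (1 - e ^ a / 2) ≤ -V * ∫ u in Ioi e, qd a e u := by
          have := qd_mass ha he he1
          nlinarith
      _ = ∫ u in Ioi e, qd a e u * (-V) := by rw [integral_mul_const, mul_comm]
      _ ≤ _ := by
        refine setIntegral_mono_on ((qd_int ha he).mul_const _) ?_ measurableSet_Ioi ?_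
        · exact mul_int measurableSet_Ioi (qd_int ha he)
            ((hP_meas hm).comp (by fun_prop : Measurable fun t : ℝ => (t, x)))
            fun t ht => hP_bound (he.trans ht) hb x
        · intro u hu
          have hu0 : 0 < u := he.trans hu
          refine mul_le_mul_of_nonneg_left ?_ (qd_nonneg ha he hu)
          rw [← hP_const hu0 (-V) x]
          exact hP_mono hu0 hm hb (integrable_const _) hv
  have hB : -(2 * c * (a * e)) ≤ ∫ t in Ioi 0, (kd a t * hP t w x - md a e t * hP t w x) := by
    obtain ⟨hmi, hmv⟩ := md_moment ha he
    calc -(2 * c * (a * e)) ≤ (-(2 * c)) * ∫ t in Ioi 0, (kd a t - md a e t) * t := by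
          nlinarith
      _ = ∫ t in Ioi 0, (-(2 * c)) * ((kd a t - md a e t) * t) := by rw [integral_const_mul]
      _ ≤ _ := by
        refine setIntegral_mono_on (hmi.const_mul _) (hi1.sub hi2) measurableSet_Ioi ?_
        intro t ht
        have h1 : 2 * (-c) * t ≤ hP t w x := by
          rw [← hP_sq ht (-c) x]
          exact hP_mono ht hw hC (sq_int _ _) hx
        have h2 := md_le ha he (show 0 < t from ht)
        nlinarith
  linarith

lemma max_principle {s : ℝ} (hs : 0 < s) (hs1 : s < 1) {w : ℝ → ℝ} (hw : Measurable w)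
    {C : ℝ} (hC : ∀ x, |w x| ≤ C) (h : ∀ x, w x < 0 → 0 ≤ hT (s / 2) w x) (x : ℝ) :
    0 ≤ hT (s / 2) w x := by
  by_contra! hneg
  have ha : 0 < s / 2 := half_pos hs
  set a := s / 2 with ha_def
  have hC' : ∀ x, |w x| ≤ C + 1 := fun x => (hC x).trans (by linarith)
  have hC0 : 0 < C + 1 := by linarith [(abs_nonneg _).trans (hC 0)]
  have hbdd : BddBelow (range (hT a w)) :=
    ⟨-C, by rintro _ ⟨y, rfl⟩; exact (abs_le.1 (hT_bound ha hw hC y)).1⟩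
  obtain ⟨V, hVdef⟩ : ∃ V, V = -⨅ y, hT a w y := ⟨_, rfl⟩
  have hv : ∀ y, -V ≤ hT a w y := fun y => by rw [hVdef, neg_neg]; exact ciInf_le hbdd y
  have hV : 0 < V := by linarith [hv x]
  obtain ⟨d, hd, huc⟩ := hT_uc hs hw hC0 hC' (half_pos hV)
  set c := (C + 1) / d ^ 2 with hc_def
  have hc : 0 < c := by positivity
  -- choice of e
  obtain ⟨e, he, he1, hee⟩ : ∃ e : ℝ, 0 < e ∧ e ≤ 1 ∧ 2 * c * (a * e) ≤ V * e ^ a / 4 := by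
    set r := min 1 (V / (8 * c * a)) with hr
    have hr0 : 0 < r := lt_min one_pos (by positivity)
    have h1a : 0 < 1 - a := by linarith
    refine ⟨r ^ (1 / (1 - a)), by positivity,
      Real.rpow_le_one hr0.le (min_le_left _ _) (by positivity), ?_⟩
    set e := r ^ (1 / (1 - a))
    have he : 0 < e := by positivity
    have h1 : e ^ (1 - a) = r := by
      rw [← Real.rpow_mul hr0.le]; field_simp; simp
    have h2 : e = e ^ (1 - a) * e ^ a := by rw [← Real.rpow_add he]; simp
    have h3 : r * (8 * c * a) ≤ V := by
      rw [← le_div_iff₀ (by positivity)]; exact min_le_right _ _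
    have h4 : 0 < e ^ a := by positivity
    rw [h1] at h2
    have h5 : 2 * c * (a * e) = (r * (8 * c * a)) * e ^ a / 4 := by
      conv_lhs => rw [h2]
      ring
    rw [h5]
    gcongr
  have hea : 0 < e ^ a := by positivity
  have hea1 : e ^ a ≤ 1 := Real.rpow_le_one he.le he1 ha.le
  obtain ⟨x0, hx0⟩ : ∃ x0, hT a w x0 < -V + V * e ^ a / 4 := by
    apply exists_lt_of_ciInf_lt
    rw [hVdef, neg_neg] at *
    have : 0 < -(⨅ y, hT a w y) * e ^ a := by positivity
    linarith
  have hx : ∀ z, -c * (x0 - z) ^ 2 ≤ w z := by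
    intro z
    by_cases hz : |x0 - z| < d
    · have := huc x0 (x0 - z) hz
      rw [sub_sub_cancel] at this
      have h1 := (abs_lt.1 this).2
      have h2 : hT a w z < 0 := by nlinarith
      have h3 : 0 ≤ w z := by
        by_contra! h4
        linarith [h z h4]
      have : 0 ≤ c * (x0 - z) ^ 2 := by positivity
      linarith
    · have h1 : d ^ 2 ≤ (x0 - z) ^ 2 := by
        rw [← sq_abs (x0 - z)]; exact pow_le_pow_left₀ hd.le (not_lt.1 hz) 2
      have h2 : C + 1 ≤ c * (x0 - z) ^ 2 := by
        calc C + 1 = c * d ^ 2 := by rw [hc_def]; field_simp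
          _ ≤ _ := by gcongr
      have := (abs_le.1 (hC' z)).1
      linarith
  have := key_bound ha he he1 hw hC hV.le hv hc.le x0 hx
  linarith

/-- A priori bounds on the infimum and supremum of fDP traveling waves. -/
theorem fDP_inf_sup_bounds (s μ κ : ℝ) (hs : s ∈ Set.Ioo (0 : ℝ) 1) (hμ : 0 < μ)
    (φ : ℝ → ℝ) (hφ : IsFDPSolution s μ κ φ) :
    0 ≤ μ ^ 2 + 8 * κ ∧
      ((∀ x, φ x = (μ - Real.sqrt (μ ^ 2 + 8 * κ)) / 4) ∨
        ((μ - Real.sqrt (μ ^ 2 + 8 * κ)) / 4 ≤ ⨅ x, φ x ∧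
          (⨅ x, φ x) ≤ (μ + Real.sqrt (μ ^ 2 + 8 * κ)) / 4 ∧
          (μ + Real.sqrt (μ ^ 2 + 8 * κ)) / 4 ≤ ⨆ x, φ x)) := by
  obtain ⟨hcont, ⟨B, hB⟩, heq⟩ := hφ
  have ha : 0 < s / 2 := half_pos hs.1
  have hm2 : Measurable fun y => φ y ^ 2 := (hcont.pow 2).measurable
  have hB0 : 0 ≤ B := (abs_nonneg _).trans (hB 0)
  have hb2 : ∀ y, |φ y ^ 2| ≤ B ^ 2 := fun y => by
    rw [abs_pow]; exact pow_le_pow_left₀ (abs_nonneg _) (hB y) 2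
  have heq' : ∀ x, -μ * φ x + (φ x) ^ 2 / 2 + (3 / 2) * hT (s / 2) (fun y => φ y ^ 2) x = κ := by
    intro x
    rw [← bessel_conv hs.1 hm2 hb2]; exact heq x
  have hbel : BddBelow (range φ) := ⟨-B, by rintro _ ⟨y, rfl⟩; exact (abs_le.1 (hB y)).1⟩
  have habv : BddAbove (range φ) := ⟨B, by rintro _ ⟨y, rfl⟩; exact (abs_le.1 (hB y)).2⟩
  obtain ⟨m, hmdef⟩ : ∃ m, m = ⨅ x, φ x := ⟨_, rfl⟩
  obtain ⟨M, hMdef⟩ : ∃ M, M = ⨆ x, φ x := ⟨_, rfl⟩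
  have hm : ∀ x, m ≤ φ x := fun x => hmdef ▸ ciInf_le hbel x
  have hM : ∀ x, φ x ≤ M := fun x => hMdef ▸ le_ciSup habv x
  have hmM : m ≤ M := (hm 0).trans (hM 0)
  have hmcl : m ∈ closure (range φ) := hmdef ▸ csInf_mem_closure (range_nonempty _) hbel
  have hMcl : M ∈ closure (range φ) := hMdef ▸ csSup_mem_closure (range_nonempty _) habv
  -- upper bound on `φ²` gives an inequality at the supremum
  have hsupIneq : (∀ x, φ x ^ 2 ≤ M ^ 2) → 0 ≤ 2 * M ^ 2 - μ * M - κ := by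
    intro h
    have hcl : IsClosed {t : ℝ | κ ≤ -μ * t + t ^ 2 / 2 + 3 / 2 * M ^ 2} :=
      isClosed_le continuous_const (by fun_prop)
    have hsub : range φ ⊆ {t : ℝ | κ ≤ -μ * t + t ^ 2 / 2 + 3 / 2 * M ^ 2} := by
      rintro _ ⟨x, rfl⟩
      have := hT_le ha hm2 hb2 h x
      have := heq' x
      simp only [mem_ofPred_eq]; linarith
    have := closure_minimal hsub hcl hMcl
    simp only [mem_ofPred_eq] at this; linarith
  rw [← hmdef, ← hMdef]
  by_cases hm0 : 0 ≤ m
  · have hcl : IsClosed {t : ℝ | -μ * t + t ^ 2 / 2 + 3 / 2 * m ^ 2 ≤ κ} :=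
      isClosed_le (by fun_prop) continuous_const
    have hsub : range φ ⊆ {t : ℝ | -μ * t + t ^ 2 / 2 + 3 / 2 * m ^ 2 ≤ κ} := by
      rintro _ ⟨x, rfl⟩
      have := hT_ge ha hm2 hb2 (fun y => pow_le_pow_left₀ hm0 (hm y) 2) x
      have := heq' x
      simp only [mem_ofPred_eq]; linarith
    have h1 := closure_minimal hsub hcl hmcl
    simp only [mem_ofPred_eq] at h1
    have h2 := hsupIneq fun x => pow_le_pow_left₀ (hm0.trans (hm x)) (hM x) 2
    have hD : 0 ≤ μ ^ 2 + 8 * κ := by nlinarith [sq_nonneg (4 * m - μ)]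
    refine ⟨hD, ?_⟩
    set R := √(μ ^ 2 + 8 * κ) with hR
    have hR0 : 0 ≤ R := Real.sqrt_nonneg _
    have hR2 : R ^ 2 = μ ^ 2 + 8 * κ := Real.sq_sqrt hD
    have h3 : |4 * m - μ| ≤ R := abs_le_of_sq_le_sq (by nlinarith) hR0
    have h4 : R ≤ |4 * M - μ| := by
      apply abs_le_of_sq_le_sq' _ (abs_nonneg _) |>.2
      rw [sq_abs]; nlinarith
    obtain ⟨h5, h6⟩ := abs_le.1 h3
    rcases le_abs'.1 h4 with h7 | h7
    · left
      intro x
      have := hm x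
      have := hM x
      linarith
    · right
      exact ⟨by linarith, by linarith, by linarith⟩
  · push Not at hm0
    obtain ⟨x1, hx1⟩ : ∃ x1, φ x1 < 0 := exists_lt_of_ciInf_lt (hmdef ▸ hm0)
    have hk0 : 0 < κ := by
      have := hT_ge ha hm2 hb2 (fun y => sq_nonneg (φ y)) x1
      have := heq' x1
      nlinarith
    have hD : 0 ≤ μ ^ 2 + 8 * κ := by positivity
    refine ⟨hD, ?_⟩
    set R := √(μ ^ 2 + 8 * κ) with hR
    have hR0 : 0 ≤ R := Real.sqrt_nonneg _
    have hR2 : R ^ 2 = μ ^ 2 + 8 * κ := Real.sq_sqrt hD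
    have hRμ : μ < R := by nlinarith
    obtain ⟨g, hg⟩ : ∃ g, g = (μ - R) / 4 := ⟨_, rfl⟩
    have hg0 : g < 0 := by linarith
    have hgr : 2 * g ^ 2 - μ * g - κ = 0 := by rw [hg]; nlinarith
    have hT' : ∀ x, hT (s / 2) (fun y => φ y ^ 2 - g ^ 2) x =
        2 / 3 * ((g - φ x) * ((g + φ x) / 2 - μ)) := by
      intro x
      rw [hT_sub_const ha hm2 hb2]
      have := heq' x
      nlinarith
    have hwm : Measurable fun y => φ y ^ 2 - g ^ 2 := hm2.sub_const _
    have hwb : ∀ y, |φ y ^ 2 - g ^ 2| ≤ B ^ 2 + g ^ 2 := fun y => by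
      have h1 := hb2 y
      rw [abs_of_nonneg (sq_nonneg _)] at h1
      rw [abs_le]; constructor <;> nlinarith [sq_nonneg (φ y), sq_nonneg g]
    have hpos := max_principle hs.1 hs.2 hwm hwb (by
      intro x hx
      rw [hT']
      have h1 : φ x ^ 2 < (-g) ^ 2 := by linarith [neg_sq g]
      obtain ⟨h2, h3⟩ := abs_lt_of_sq_lt_sq' h1 (by linarith)
      have : 0 ≤ (φ x - g) * (μ - (g + φ x) / 2) :=
        mul_nonneg (by linarith) (by linarith)
      linarith)
    have hlow : ∀ x, g ≤ φ x := by
      intro x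
      by_contra! h
      have h1 := hpos x
      rw [hT'] at h1
      have : 0 < (g - φ x) * (μ - (g + φ x) / 2) :=
        mul_pos (by linarith) (by linarith)
      linarith
    rw [← hg]
    by_cases hMg : M ≤ -g
    · left
      intro x
      have h1 := hT_le ha hwm hwb (b := 0) (fun y => by
        have h2 := hlow y
        have h3 := hM y
        nlinarith) x
      rw [hT'] at h1
      by_contra hne
      have h2 : g < φ x := lt_of_le_of_ne (hlow x) (Ne.symm hne)
      have h3 := hM x
      have : 0 < (φ x - g) * (μ - (g + φ x) / 2) :=
        mul_pos (by linarith) (by linarith)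
      linarith
    · right
      push Not at hMg
      have h2 := hsupIneq fun x => sq_le_sq' (by linarith [hlow x]) (hM x)
      refine ⟨hmdef ▸ le_ciInf hlow, by linarith, ?_⟩
      have h4 : R ≤ |4 * M - μ| := by
        apply abs_le_of_sq_le_sq' _ (abs_nonneg _) |>.2
        rw [sq_abs]; nlinarith
      rcases le_abs'.1 h4 with h7 | h7 <;> linarith
end
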